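/- For all fixed integers e > r ≥ 3 with gcd(e-1, r) = 1, one has ex_r(n, ℋ_r(0,e)) = Ω(n^{r-1+r/(e-1)} (log n)^{1/(e-1)}); that is, there exist a constant c > 0 and an integer N such that for every n ≥ N there exists an r-graph H on vertex set [n] with at least c · n^{r-1+r/(e-1)} · (log n)^{1/(e-1)} edges such that for every integer i with 1 ≤ i ≤ e, the union of any i distinct edges of H contains at least i vertices. -/

import Mathlib

set_option linter.unusedSectionVars false

namespace Uncrowded
open Finset

/-- Uniform, linear hypergraphs without cycles of length three or four. -/
structure Good {V : Type*} (E : Finset (Finset V)) (k : ℕ) : Prop where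
  card : ∀ f ∈ E, f.card = k
  lin : ∀ f ∈ E, ∀ g ∈ E, ∀ x y, x ≠ y → x ∈ f → y ∈ f → x ∈ g → y ∈ g → f = g
  c3 : ∀ f ∈ E, ∀ g ∈ E, ∀ h ∈ E, ∀ x y z, x ≠ y → y ≠ z → x ≠ z →
    x ∈ f → y ∈ f → y ∈ g → z ∈ g → z ∈ h → x ∈ h → f = g
  c4 : ∀ f ∈ E, ∀ g ∈ E, ∀ h ∈ E, ∀ l ∈ E, ∀ x y z q, x ≠ y → x ≠ z → x ≠ q → y ≠ z → y ≠ q →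
    z ≠ q → x ∈ f → y ∈ f → y ∈ g → z ∈ g → z ∈ h → q ∈ h → q ∈ l → x ∈ l →
    f = g ∨ g = h ∨ h = l ∨ l = f

variable {V : Type*} [Fintype V] [DecidableEq V]

/-- Weighted number of edges through `u` having exactly `j` vertices outside `I`. -/
noncomputable def dg (E : Finset (Finset V)) (I : Finset V) (w : V → ℝ) (j : ℕ) (u : V) : ℝ :=
  ∑ f ∈ E with (u ∈ f ∧ (f \ I).card = j), ∏ x ∈ (f \ I).erase u, w x

/-- Vertices whose selection removes `u`. -/
def K (E : Finset (Finset V)) (I : Finset V) (u : V) : Finset V :=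
  univ.filter (fun v => v = u ∨ ∃ f ∈ E, f \ I = {u, v})

/-- Probability that `u` is removed. -/
noncomputable def pk (E : Finset (Finset V)) (I : Finset V) (w : V → ℝ) (ε : ℝ) (u : V) : ℝ :=
  ε * ∑ v ∈ K E I u, w v

/-- Compensated weight. -/
noncomputable def wp (E : Finset (Finset V)) (I : Finset V) (w : V → ℝ) (ε : ℝ) (u : V) : ℝ :=
  w u / (1 - pk E I w ε u)

/-- New weight after selecting `v`. -/
noncomputable def wn (E : Finset (Finset V)) (I : Finset V) (w : V → ℝ) (ε : ℝ) (v u : V) : ℝ :=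
  if v ∈ K E I u then 0 else wp E I w ε u

/-- Gain for rank `j` edges at `u` when `v` is selected. -/
noncomputable def gv (E : Finset (Finset V)) (I : Finset V) (w : V → ℝ) (j : ℕ) (u v : V) : ℝ :=
  ∑ f ∈ E with ((u ∈ f ∧ (f \ I).card = j + 1) ∧ v ∈ f), ∏ x ∈ ((f \ I).erase u).erase v, w x

/-- Loss for rank `j` edges at `u` when `v` is selected. -/
noncomputable def lv (E : Finset (Finset V)) (I : Finset V) (w : V → ℝ) (j : ℕ) (u v : V) : ℝ :=
  ∑ f ∈ E with ((u ∈ f ∧ (f \ I).card = j) ∧ ∃ x ∈ (f \ I).erase u, v ∈ K E I x),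
    ∏ x ∈ (f \ I).erase u, w x

variable {E : Finset (Finset V)} {I : Finset V} {w : V → ℝ} {k j : ℕ} {u v : V} {ε Q pm θ : ℝ}

lemma mem_K_self : u ∈ K E I u := by simp [K]

lemma mem_K : v ∈ K E I u ↔ v = u ∨ ∃ f ∈ E, f \ I = {u, v} := by simp [K]

lemma overlap (hG : Good E k) {f : Finset V} (hf : f ∈ E) {x y : V} (hx : x ∈ f) (hy : y ∈ f)
    (hxy : x ≠ y) (h1 : v ∈ K E I x) (h2 : v ∈ K E I y) : v ∈ f := by
  by_contra hv
  rw [mem_K] at h1 h2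
  rcases h1 with rfl | ⟨g, hg, hgI⟩
  · exact hv hx
  rcases h2 with rfl | ⟨h, hh, hhI⟩
  · exact hv hy
  have hvx : x ≠ v := by rintro rfl; exact hv hx
  have hvy : y ≠ v := by rintro rfl; exact hv hy
  have m1 : x ∈ g \ I := by rw [hgI]; simp
  have m2 : v ∈ g \ I := by rw [hgI]; simp
  have m3 : y ∈ h \ I := by rw [hhI]; simp
  have m4 : v ∈ h \ I := by rw [hhI]; simp
  simp only [mem_sdiff] at m1 m2 m3 m4
  have := hG.c3 g hg h hh f hf x v y hvx hvy.symm hxy m1.1 m2.1 m4.1 m3.1 hy hx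
  subst this
  have : y ∈ g \ I := mem_sdiff.2 m3
  rw [hgI] at this
  simp at this
  rcases this with h | h
  · exact hxy h.symm
  · exact hvy h

lemma dg_nonneg (hw : ∀ x, 0 ≤ w x) : 0 ≤ dg E I w j u :=
  sum_nonneg fun _ _ => prod_nonneg fun _ _ => hw _

lemma gv_nonneg (hw : ∀ x, 0 ≤ w x) : 0 ≤ gv E I w j u v :=
  sum_nonneg fun _ _ => prod_nonneg fun _ _ => hw _

lemma lv_nonneg (hw : ∀ x, 0 ≤ w x) : 0 ≤ lv E I w j u v :=
  sum_nonneg fun _ _ => prod_nonneg fun _ _ => hw _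

lemma dg_mono {w' : V → ℝ} (hw : ∀ x, 0 ≤ w x) (hww : ∀ x, w x ≤ w' x) :
    dg E I w j u ≤ dg E I w' j u :=
  sum_le_sum fun _ _ => prod_le_prod (fun _ _ => hw _) fun _ _ => hww _

lemma gv_le (hG : Good E k) (hw : ∀ x, 0 ≤ w x) (hQ : 0 ≤ Q) (hwQ : ∀ x, w x ≤ Q)
    (huI : u ∉ I) (hvI : v ∉ I) (huv : u ≠ v) : gv E I w j u v ≤ Q ^ (j - 1) := by
  unfold gv
  have hc : (E.filter fun f => (u ∈ f ∧ (f \ I).card = j + 1) ∧ v ∈ f).card ≤ 1 := by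
    rw [card_le_one]
    intro a ha b hb
    simp only [mem_filter] at ha hb
    exact hG.lin a ha.1 b hb.1 u v huv ha.2.1.1 ha.2.2 hb.2.1.1 hb.2.2
  calc _ ≤ ∑ f ∈ E with ((u ∈ f ∧ (f \ I).card = j + 1) ∧ v ∈ f), Q ^ (j - 1) := by
        apply sum_le_sum
        intro f hf
        simp only [mem_filter] at hf
        have : (((f \ I).erase u).erase v).card = j - 1 := by
          rw [card_erase_of_mem, card_erase_of_mem, hf.2.1.2]
          · omega
          · simp [hf.2.1.1, huI]
          · simp [hf.2.2, hvI, huv.symm]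
        rw [← this]
        exact prod_le_pow_card' _ _ _ hw hwQ
    _ ≤ _ := by
        rw [sum_const, nsmul_eq_mul]
        have h : ((E.filter fun f => (u ∈ f ∧ (f \ I).card = j + 1) ∧ v ∈ f).card : ℝ) ≤ 1 := by
          exact_mod_cast hc
        nlinarith [pow_nonneg hQ (j - 1)]
  where
  prod_le_pow_card' (s : Finset V) (w : V → ℝ) (Q : ℝ) (hw : ∀ x, 0 ≤ w x) (hwQ : ∀ x, w x ≤ Q) :
      ∏ x ∈ s, w x ≤ Q ^ s.card := by
    calc _ ≤ ∏ x ∈ s, Q := prod_le_prod (fun _ _ => hw _) fun _ _ => hwQ _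
      _ = _ := by simp

lemma lv_le (hG : Good E k) (hw : ∀ x, 0 ≤ w x) (hQ : 0 ≤ Q) (hwQ : ∀ x, w x ≤ Q)
    (huI : u ∉ I) (hvK : v ∉ K E I u) :
    lv E I w j u v ≤ 2 * Q ^ (j - 1) := by
  have huv : u ≠ v := by rintro rfl; exact hvK mem_K_self
  unfold lv
  set A := E.filter fun f => (u ∈ f ∧ (f \ I).card = j) ∧ ∃ x ∈ (f \ I).erase u, v ∈ K E I x with hA
  have h1 : (A.filter fun f => v ∈ f).card ≤ 1 := by
    rw [card_le_one]
    intro a ha b hb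
    simp only [hA, mem_filter] at ha hb
    exact hG.lin a ha.1.1 b hb.1.1 u v huv ha.1.2.1.1 ha.2 hb.1.2.1.1 hb.2
  have h2 : (A.filter fun f => v ∉ f).card ≤ 1 := by
    rw [card_le_one]
    intro a ha b hb
    simp only [hA, mem_filter] at ha hb
    obtain ⟨⟨haE, ⟨hua, -⟩, x, hx, hvx⟩, hva⟩ := ha
    obtain ⟨⟨hbE, ⟨hub, -⟩, y, hy, hvy⟩, hvb⟩ := hb
    by_contra hab
    simp only [mem_erase, mem_sdiff] at hx hy
    rw [mem_K] at hvx hvy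
    rcases hvx with rfl | ⟨g, hg, hgI⟩
    · exact hva hx.2.1
    rcases hvy with rfl | ⟨h, hh, hhI⟩
    · exact hvb hy.2.1
    have hxy : x ≠ y := by
      rintro rfl
      exact hab (hG.lin a haE b hbE x u hx.1 hx.2.1 hua hy.2.1 hub)
    have hxv : x ≠ v := by rintro rfl; exact hva hx.2.1
    have hyv : y ≠ v := by rintro rfl; exact hvb hy.2.1
    have m1 : x ∈ g \ I := by rw [hgI]; simp
    have m2 : v ∈ g \ I := by rw [hgI]; simp
    have m3 : y ∈ h \ I := by rw [hhI]; simp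
    have m4 : v ∈ h \ I := by rw [hhI]; simp
    have m3' := m3
    simp only [mem_sdiff] at m1 m2 m3 m4
    rcases hG.c4 a haE g hg h hh b hbE u x v y hx.1.symm huv hy.1.symm hxv hxy hyv.symm
      hua hx.2.1 m1.1 m2.1 m4.1 m3.1 hy.2.1 hub with e | e | e | e
    · subst e; exact hva m2.1
    · subst e
      rw [hgI] at m3'
      simp at m3'
      rcases m3' with h | h
      · exact hxy h.symm
      · exact hyv h
    · subst e; exact hvb m4.1
    · exact hab e.symm
  have hc : A.card ≤ 2 := by
    rw [← card_filter_add_card_filter_not (s := A) (fun f => v ∈ f)]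
    omega
  calc _ ≤ ∑ f ∈ A, Q ^ (j - 1) := by
        apply sum_le_sum
        intro f hf
        simp only [hA, mem_filter] at hf
        have : ((f \ I).erase u).card = j - 1 := by
          rw [card_erase_of_mem, hf.2.1.2]
          simp [hf.2.1.1, huI]
        rw [← this]
        exact gv_le.prod_le_pow_card' _ _ _ hw hwQ
    _ ≤ _ := by
        rw [sum_const, nsmul_eq_mul]
        have h : (A.card : ℝ) ≤ 2 := by exact_mod_cast hc
        exact mul_le_mul_of_nonneg_right h (pow_nonneg hQ (j - 1))

lemma dg_step (hw : ∀ x, 0 ≤ wp E I w ε x) (hvI : v ∉ I)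
    (hvK : v ∉ K E I u) :
    dg E (insert v I) (wn E I w ε v) j u ≤
      dg E I (wp E I w ε) j u + gv E I (wp E I w ε) j u v - lv E I (wp E I w ε) j u v := by
  have huv : u ≠ v := by rintro rfl; exact hvK mem_K_self
  have hwn : ∀ x, 0 ≤ wn E I w ε v x := fun x => by unfold wn; split_ifs; exacts [le_rfl, hw x]
  have hwn' : ∀ x, wn E I w ε v x ≤ wp E I w ε x := fun x => by
    unfold wn; split_ifs; exacts [hw x, le_rfl]
  have key : dg E I (wp E I w ε) j u = lv E I (wp E I w ε) j u v +
      ∑ f ∈ E with ((u ∈ f ∧ (f \ I).card = j) ∧ ¬ ∃ x ∈ (f \ I).erase u, v ∈ K E I x),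
    ∏ x ∈ (f \ I).erase u, wp E I w ε x := by
    unfold dg lv
    have h := sum_filter_add_sum_filter_not (E.filter fun f => u ∈ f ∧ (f \ I).card = j)
      (fun f => ∃ x ∈ (f \ I).erase u, v ∈ K E I x)
      (fun f => ∏ x ∈ (f \ I).erase u, wp E I w ε x)
    rw [filter_filter, filter_filter] at h
    exact h.symm
  rw [key]
  have : dg E (insert v I) (wn E I w ε v) j u ≤ gv E I (wp E I w ε) j u v + 
      ∑ f ∈ E with ((u ∈ f ∧ (f \ I).card = j) ∧ ¬ ∃ x ∈ (f \ I).erase u, v ∈ K E I x),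
    ∏ x ∈ (f \ I).erase u, wp E I w ε x := by
    unfold dg
    rw [← sum_filter_add_sum_filter_not _ (fun f => v ∈ f)]
    apply add_le_add
    · unfold gv
      apply le_trans _ (sum_le_sum_of_subset_of_nonneg (s := filter (fun f => v ∈ f)
        (E.filter fun f => u ∈ f ∧ (f \ insert v I).card = j)) _ _)
      · apply sum_le_sum
        intro f hf
        simp only [mem_filter] at hf
        have : (f \ insert v I).erase u = ((f \ I).erase u).erase v := by
          ext x; simp only [mem_erase, mem_sdiff, mem_insert]; tauto
        rw [this]
        exact prod_le_prod (fun _ _ => hwn _) fun _ _ => hwn' _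
      · intro f hf
        simp only [mem_filter] at hf ⊢
        refine ⟨hf.1.1, ⟨hf.1.2.1, ?_⟩, hf.2⟩
        have : f \ insert v I = (f \ I).erase v := by
          ext x; simp only [mem_erase, mem_sdiff, mem_insert]; tauto
        have h2 := hf.1.2.2
        have hm : v ∈ f \ I := by simp [hf.2, hvI]
        rw [this, card_erase_of_mem hm] at h2
        have := card_pos.2 ⟨v, hm⟩
        omega
      · intro _ _ _
        exact prod_nonneg fun _ _ => hw _
    · have e1 : ∀ f ∈ filter (fun f => v ∉ f) (E.filter fun f => u ∈ f ∧ (f \ insert v I).card = j),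
          ∏ x ∈ (f \ insert v I).erase u, wn E I w ε v x ≤
          if (∃ x ∈ (f \ I).erase u, v ∈ K E I x) then 0 else 
            ∏ x ∈ (f \ I).erase u, wp E I w ε x := by
        intro f hf
        simp only [mem_filter] at hf
        have : f \ insert v I = f \ I := by
          ext x; simp only [mem_sdiff, mem_insert]
          constructor
          · tauto
          · rintro ⟨h1, h2⟩
            refine ⟨h1, ?_⟩
            rintro (rfl | h)
            · exact hf.2 h1
            · exact h2 h
        rw [this]
        split_ifs with hb
        · obtain ⟨x, hx, hv⟩ := hb
          rw [prod_eq_zero hx]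
          simp [wn, hv]
        · exact prod_le_prod (fun _ _ => hwn _) fun _ _ => hwn' _
      refine (sum_le_sum e1).trans ?_
      rw [sum_ite, sum_const_zero, zero_add]
      apply sum_le_sum_of_subset_of_nonneg
      · intro f hf
        simp only [mem_filter] at hf ⊢
        refine ⟨hf.1.1.1, ⟨hf.1.1.2.1, ?_⟩, hf.2⟩
        rw [← hf.1.1.2.2]
        congr 1
        ext x; simp only [mem_sdiff, mem_insert]
        constructor
        · rintro ⟨h1, h2⟩
          refine ⟨h1, ?_⟩
          rintro (rfl | h)
          · exact hf.1.2 h1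
          · exact h2 h
        · tauto
      · intro _ _ _
        exact prod_nonneg fun _ _ => hw _
  linarith

lemma sum_gv_le (hw0 : ∀ x, 0 ≤ w x) (hww : ∀ x, w x ≤ wp E I w ε x)
    (hwI : ∀ x, x ∈ I → w x = 0) (huI : u ∉ I) :
    ∑ v ∈ univ.filter (fun v => v ∉ K E I u), w v * gv E I (wp E I w ε) j u v ≤
      j * dg E I (wp E I w ε) (j + 1) u := by
  have hwp : ∀ x, 0 ≤ wp E I w ε x := fun x => (hw0 x).trans (hww x)
  calc _ ≤ ∑ v ∈ univ.filter (fun v => v ≠ u), w v * gv E I (wp E I w ε) j u v := by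
        apply sum_le_sum_of_subset_of_nonneg
        · intro v hv
          simp only [mem_filter, mem_univ, true_and] at hv ⊢
          rintro rfl
          exact hv mem_K_self
        · intro v _ _
          exact mul_nonneg (hw0 _) (gv_nonneg hwp)
    _ = ∑ v ∈ univ.filter (fun v => v ≠ u), ∑ f ∈ E with (u ∈ f ∧ (f \ I).card = j + 1),
          if v ∈ f then w v * ∏ x ∈ ((f \ I).erase u).erase v, wp E I w ε x else 0 := by
        apply sum_congr rfl
        intro v _
        unfold gv
        rw [← filter_filter, mul_sum, sum_filter]
    _ = ∑ f ∈ E with (u ∈ f ∧ (f \ I).card = j + 1), ∑ v ∈ univ.filter (fun v => v ≠ u), 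
          if v ∈ f then w v * ∏ x ∈ ((f \ I).erase u).erase v, wp E I w ε x else 0 := sum_comm
    _ ≤ ∑ f ∈ E with (u ∈ f ∧ (f \ I).card = j + 1), 
          (j : ℝ) * ∏ x ∈ (f \ I).erase u, wp E I w ε x := by
        apply sum_le_sum
        intro f hf
        simp only [mem_filter] at hf
        have hc : ((f \ I).erase u).card = j := by
          rw [card_erase_of_mem, hf.2.2]
          · rfl
          · simp [hf.2.1, huI]
        calc _ ≤ ∑ v ∈ (f \ I).erase u, w v * ∏ x ∈ ((f \ I).erase u).erase v, wp E I w ε x := by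
              rw [← sum_filter]
              refine (sum_subset ?_ ?_).symm.le
              · intro v hv
                simp only [mem_erase, mem_sdiff] at hv
                simp [hv.1, hv.2.1]
              · intro v hv hne
                simp only [mem_filter, mem_univ, true_and] at hv
                simp only [mem_erase, mem_sdiff] at hne
                have h : v ∈ I := by
                  by_contra h
                  exact hne ⟨hv.1, hv.2, h⟩
                rw [hwI v h, zero_mul]
          _ ≤ ∑ v ∈ (f \ I).erase u, ∏ x ∈ (f \ I).erase u, wp E I w ε x := by
              apply sum_le_sum
              intro v hv
              rw [← mul_prod_erase _ _ hv]
              exact mul_le_mul_of_nonneg_right (hww v) (prod_nonneg fun _ _ => hwp _)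
          _ = _ := by rw [sum_const, hc, nsmul_eq_mul]
    _ = _ := by rw [← mul_sum]; rfl

lemma edge_overlap (hG : Good E k) (hw0 : ∀ x, 0 ≤ w x) (hwQ : ∀ x, w x ≤ Q)
    {f : Finset V} (hf : f ∈ E) (hu : u ∈ f) :
    ∑ x ∈ (f \ I).erase u, ∑ v ∈ K E I x, w v ≤
      ∑ v ∈ univ.filter (fun v => v ∉ K E I u ∧ ∃ x ∈ (f \ I).erase u, v ∈ K E I x), w v +
        (k : ℝ) ^ 2 * Q := by
  have h1 : ∑ x ∈ (f \ I).erase u, ∑ v ∈ K E I x, w v =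
      ∑ v, ((((f \ I).erase u).filter fun x => v ∈ K E I x).card : ℝ) * w v := by
    calc _ = ∑ x ∈ (f \ I).erase u, ∑ v, if v ∈ K E I x then w v else 0 := by
          apply sum_congr rfl
          intro x _
          rw [← sum_filter]
          congr 1
          ext; simp
      _ = ∑ v, ∑ x ∈ (f \ I).erase u, if v ∈ K E I x then w v else 0 := sum_comm
      _ = _ := by
          apply sum_congr rfl
          intro v _
          rw [← sum_filter, sum_const, nsmul_eq_mul]
  have h2 : ∀ v, ((((f \ I).erase u).filter fun x => v ∈ K E I x).card : ℝ) * w v ≤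
      (if (v ∉ K E I u ∧ ∃ x ∈ (f \ I).erase u, v ∈ K E I x) then w v else 0) +
      (if v ∈ f then (k : ℝ) * Q else 0) := by
    intro v
    have hk0 : (0 : ℝ) ≤ k := by positivity
    have hQ0 : 0 ≤ Q := (hw0 v).trans (hwQ v)
    by_cases hv : v ∈ f
    · rw [if_pos hv]
      have a1 : ((((f \ I).erase u).filter fun x => v ∈ K E I x).card : ℝ) ≤ k := by
        rw [← hG.card f hf]
        exact_mod_cast card_le_card ((filter_subset _ _).trans ((erase_subset _ _).trans sdiff_subset))
      have a2 : 0 ≤ (if (v ∉ K E I u ∧ ∃ x ∈ (f \ I).erase u, v ∈ K E I x) then w v else 0) := by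
        split_ifs; exacts [hw0 v, le_rfl]
      have := mul_le_mul a1 (hwQ v) (hw0 v) hk0
      linarith
    · rw [if_neg hv, add_zero]
      by_cases hx : ∃ x ∈ (f \ I).erase u, v ∈ K E I x
      · obtain ⟨x, hx, hvx⟩ := hx
        have hx' := hx
        simp only [mem_erase, mem_sdiff] at hx'
        have hn : v ∉ K E I u := fun h => hv (overlap hG hf hx'.2.1 hu hx'.1 hvx h)
        rw [if_pos ⟨hn, x, hx, hvx⟩]
        have : (((f \ I).erase u).filter fun x => v ∈ K E I x).card ≤ 1 := by
          rw [card_le_one]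
          intro a ha b hb
          simp only [mem_filter, mem_erase, mem_sdiff] at ha hb
          by_contra hab
          exact hv (overlap hG hf ha.1.2.1 hb.1.2.1 hab ha.2 hb.2)
        have : ((((f \ I).erase u).filter fun x => v ∈ K E I x).card : ℝ) ≤ 1 := by
          exact_mod_cast this
        nlinarith [hw0 v]
      · rw [if_neg (fun h => hx h.2)]
        have : (((f \ I).erase u).filter fun x => v ∈ K E I x) = ∅ := by
          rw [filter_eq_empty_iff]
          intro x hx1 hx2
          exact hx ⟨x, hx1, hx2⟩
        simp [this]
  rw [h1]
  refine (sum_le_sum fun v _ => h2 v).trans ?_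
  rw [sum_add_distrib, ← sum_filter, ← sum_filter]
  have : ∑ v ∈ univ.filter (fun v => v ∈ f), (k : ℝ) * Q = (k : ℝ) ^ 2 * Q := by
    rw [sum_const, nsmul_eq_mul]
    have : univ.filter (fun v => v ∈ f) = f := by ext; simp
    rw [this, hG.card f hf]; ring
  rw [this]

lemma sum_lv_eq :
    ∑ v ∈ univ.filter (fun v => v ∉ K E I u), w v * lv E I (wp E I w ε) j u v =
    ∑ f ∈ E with (u ∈ f ∧ (f \ I).card = j), (∏ x ∈ (f \ I).erase u, wp E I w ε x) *
      ∑ v ∈ univ.filter (fun v => v ∉ K E I u ∧ ∃ x ∈ (f \ I).erase u, v ∈ K E I x), w v := by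
  calc _ = ∑ v ∈ univ.filter (fun v => v ∉ K E I u), ∑ f ∈ E with (u ∈ f ∧ (f \ I).card = j),
        if (∃ x ∈ (f \ I).erase u, v ∈ K E I x) then 
          (∏ x ∈ (f \ I).erase u, wp E I w ε x) * w v else 0 := by
        apply sum_congr rfl
        intro v _
        unfold lv
        rw [← filter_filter, mul_sum, sum_filter]
        apply sum_congr rfl
        intro f _
        split_ifs <;> ring
    _ = ∑ f ∈ E with (u ∈ f ∧ (f \ I).card = j), ∑ v ∈ univ.filter (fun v => v ∉ K E I u), 
        if (∃ x ∈ (f \ I).erase u, v ∈ K E I x) then 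
          (∏ x ∈ (f \ I).erase u, wp E I w ε x) * w v else 0 := sum_comm
    _ = _ := by
        apply sum_congr rfl
        intro f _
        rw [mul_sum, ← sum_filter, filter_filter]

end Uncrowded

set_option linter.unusedSectionVars false

namespace Uncrowded
open Finset
variable {V : Type*} [Fintype V] [DecidableEq V]
variable {E : Finset (Finset V)} {I : Finset V} {w : V → ℝ} {k j : ℕ} {u v : V} {ε Q pm θ : ℝ}

lemma pk_nonneg (hw0 : ∀ x, 0 ≤ w x) (hε : 0 ≤ ε) (x : V) : 0 ≤ pk E I w ε x :=
  mul_nonneg hε (sum_nonneg fun _ _ => hw0 _)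

lemma wp_mul (hpm : pm ≤ 1 / 2) (hp : ∀ x, w x ≠ 0 → pk E I w ε x ≤ pm) (x : V) :
    w x = wp E I w ε x * (1 - pk E I w ε x) := by
  unfold wp
  by_cases h : w x = 0
  · simp [h]
  · have := hp x h
    rw [div_mul_cancel₀]
    linarith

lemma wp_nonneg (hw0 : ∀ x, 0 ≤ w x) (hpm : pm ≤ 1 / 2)
    (hp : ∀ x, w x ≠ 0 → pk E I w ε x ≤ pm) (x : V) : 0 ≤ wp E I w ε x := by
  unfold wp
  by_cases h : w x = 0
  · simp [h]
  · have := hp x h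
    exact div_nonneg (hw0 x) (by linarith)

lemma le_wp (hw0 : ∀ x, 0 ≤ w x) (hε : 0 ≤ ε) (hpm : pm ≤ 1 / 2)
    (hp : ∀ x, w x ≠ 0 → pk E I w ε x ≤ pm) (x : V) : w x ≤ wp E I w ε x := by
  have h1 := wp_mul hpm hp x
  have h2 := wp_nonneg hw0 hpm hp x
  have h3 := pk_nonneg (E := E) (I := I) hw0 hε x
  nlinarith

lemma wp_le (hw0 : ∀ x, 0 ≤ w x) (hε : 0 ≤ ε) (hpm : pm ≤ 1 / 2)
    (hp : ∀ x, w x ≠ 0 → pk E I w ε x ≤ pm) (x : V) :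
    wp E I w ε x ≤ (1 + 2 * pm) * w x := by
  by_cases h : w x = 0
  · simp [wp, h]
  have h0 := hp x h
  have h2 := hw0 x
  have h3 := pk_nonneg (E := E) (I := I) hw0 hε x
  unfold wp
  rw [div_le_iff₀ (by linarith)]
  have : 1 ≤ (1 + 2 * pm) * (1 - pk E I w ε x) := by nlinarith
  nlinarith

lemma dg_wp_le (hG : Good E k) (hw0 : ∀ x, 0 ≤ w x) (hε : 0 ≤ ε) (hpm0 : 0 ≤ pm) (hpm : pm ≤ 1 / 2)
    (hpm2 : (1 + 2 * pm) ^ k ≤ 2)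
    (hp : ∀ x, w x ≠ 0 → pk E I w ε x ≤ pm) :
    dg E I (wp E I w ε) j u ≤ 2 * dg E I w j u := by
  unfold dg
  rw [mul_sum]
  apply sum_le_sum
  intro f hf
  simp only [mem_filter] at hf
  have h0 : 0 ≤ ∏ x ∈ (f \ I).erase u, w x := prod_nonneg fun _ _ => hw0 _
  calc _ ≤ ∏ x ∈ (f \ I).erase u, ((1 + 2 * pm) * w x) :=
        prod_le_prod (fun x _ => wp_nonneg hw0 hpm hp x) fun x _ => wp_le hw0 hε hpm hp x
    _ = (1 + 2 * pm) ^ ((f \ I).erase u).card * ∏ x ∈ (f \ I).erase u, w x := by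
        rw [prod_mul_distrib, prod_const]
    _ ≤ _ := by
        apply mul_le_mul_of_nonneg_right _ h0
        refine le_trans (pow_le_pow_right₀ (by linarith) ?_) hpm2
        rw [← hG.card f hf.1]
        exact card_le_card ((erase_subset _ _).trans sdiff_subset)

lemma one_sub_sum_le_prod {ι : Type*} (s : Finset ι) (p : ι → ℝ) (h0 : ∀ i ∈ s, 0 ≤ p i)
    (h1 : ∀ i ∈ s, p i ≤ 1) : 1 - ∑ i ∈ s, p i ≤ ∏ i ∈ s, (1 - p i) := by
  classical
  induction s using Finset.induction_on with
  | empty => simp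
  | insert a s ha ih =>
    rw [sum_insert ha, prod_insert ha]
    have i1 := ih (fun i hi => h0 i (mem_insert_of_mem hi)) (fun i hi => h1 i (mem_insert_of_mem hi))
    have i2 := h0 a (mem_insert_self _ _)
    have i3 := h1 a (mem_insert_self _ _)
    have i4 : 0 ≤ ∑ i ∈ s, p i := sum_nonneg fun i hi => h0 i (mem_insert_of_mem hi)
    nlinarith

/-- the expected loss, as a sum over edges -/
lemma dg_wp_sub (hw0 : ∀ x, 0 ≤ w x) (hε : 0 ≤ ε) (hpm : pm ≤ 1 / 2)
    (hp : ∀ x, w x ≠ 0 → pk E I w ε x ≤ pm) :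
    dg E I (wp E I w ε) j u - dg E I w j u ≤
      ∑ f ∈ E with (u ∈ f ∧ (f \ I).card = j), (∏ x ∈ (f \ I).erase u, wp E I w ε x) *
        ∑ x ∈ (f \ I).erase u, pk E I w ε x := by
  unfold dg
  rw [← sum_sub_distrib]
  apply sum_le_sum
  intro f _
  have hn : 0 ≤ ∏ x ∈ (f \ I).erase u, wp E I w ε x :=
    prod_nonneg fun x _ => wp_nonneg hw0 hpm hp x
  by_cases h : ∀ x ∈ (f \ I).erase u, w x ≠ 0
  · have e : ∏ x ∈ (f \ I).erase u, w x = (∏ x ∈ (f \ I).erase u, wp E I w ε x) *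
        ∏ x ∈ (f \ I).erase u, (1 - pk E I w ε x) := by
      rw [← prod_mul_distrib]
      exact prod_congr rfl fun x _ => wp_mul hpm hp x
    rw [e]
    have := one_sub_sum_le_prod ((f \ I).erase u) (pk E I w ε)
      (fun x _ => pk_nonneg hw0 hε x) (fun x hx => by have := hp x (h x hx); linarith)
    nlinarith
  · push Not at h
    obtain ⟨x, hx, hx0⟩ := h
    rw [prod_eq_zero hx (by simp [wp, hx0]), prod_eq_zero hx hx0]
    simp

lemma sum_pk_ge (hG : Good E k) (hw0 : ∀ x, 0 ≤ w x) (hε : 0 ≤ ε) (hpm : pm ≤ 1 / 2)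
    (hp : ∀ x, w x ≠ 0 → pk E I w ε x ≤ pm) (hwQ : ∀ x, w x ≤ Q) :
    ∑ f ∈ E with (u ∈ f ∧ (f \ I).card = j), (∏ x ∈ (f \ I).erase u, wp E I w ε x) *
        ∑ x ∈ (f \ I).erase u, pk E I w ε x ≤
    ε * ∑ v ∈ univ.filter (fun v => v ∉ K E I u), w v * lv E I (wp E I w ε) j u v +
      ε * (k : ℝ) ^ 2 * Q * dg E I (wp E I w ε) j u := by
  rw [sum_lv_eq]
  unfold dg
  rw [mul_sum, mul_sum, ← sum_add_distrib]
  apply sum_le_sum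
  intro f hf
  simp only [mem_filter] at hf
  have hn : 0 ≤ ∏ x ∈ (f \ I).erase u, wp E I w ε x :=
    prod_nonneg fun x _ => wp_nonneg hw0 hpm hp x
  have := edge_overlap (I := I) hG hw0 hwQ hf.1 hf.2.1
  have e : ∑ x ∈ (f \ I).erase u, pk E I w ε x =
      ε * ∑ x ∈ (f \ I).erase u, ∑ v ∈ K E I x, w v := by
    rw [mul_sum]; rfl
  rw [e]
  have h2 := mul_le_mul_of_nonneg_left this (mul_nonneg hn hε)
  linarith

lemma sum_biUnion_le' {ι : Type*} [DecidableEq ι] (s : Finset ι) (t : ι → Finset V)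
    (hw0 : ∀ x, 0 ≤ w x) : ∑ v ∈ s.biUnion t, w v ≤ ∑ i ∈ s, ∑ v ∈ t i, w v := by
  induction s using Finset.induction_on with
  | empty => simp
  | insert a s ha ih =>
    rw [biUnion_insert, sum_insert ha]
    have h1 := sum_union_inter (s₁ := t a) (s₂ := s.biUnion t) (f := w)
    have h2 : 0 ≤ ∑ v ∈ t a ∩ s.biUnion t, w v := sum_nonneg fun _ _ => hw0 _
    linarith

lemma sum_lv_le (hG : Good E k) (hw0 : ∀ x, 0 ≤ w x) (hε : 0 ≤ ε) (hpm0 : 0 ≤ pm) (hpm : pm ≤ 1 / 2)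
    (hp : ∀ x, w x ≠ 0 → pk E I w ε x ≤ pm) :
    ε * ∑ v ∈ univ.filter (fun v => v ∉ K E I u), w v * lv E I (wp E I w ε) j u v ≤
      k * pm * dg E I (wp E I w ε) j u := by
  rw [sum_lv_eq]
  unfold dg
  rw [mul_sum, mul_sum]
  apply sum_le_sum
  intro f hf
  simp only [mem_filter] at hf
  have hn : 0 ≤ ∏ x ∈ (f \ I).erase u, wp E I w ε x :=
    prod_nonneg fun x _ => wp_nonneg hw0 hpm hp x
  by_cases h : ∀ x ∈ (f \ I).erase u, w x ≠ 0
  · have a1 : ∑ v ∈ univ.filter (fun v => v ∉ K E I u ∧ ∃ x ∈ (f \ I).erase u, v ∈ K E I x), w v ≤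
        ∑ x ∈ (f \ I).erase u, ∑ v ∈ K E I x, w v := by
      calc _ ≤ ∑ v ∈ ((f \ I).erase u).biUnion (K E I), w v := by
            apply sum_le_sum_of_subset_of_nonneg
            · intro v hv
              simp only [mem_filter, mem_univ, true_and] at hv
              rw [mem_biUnion]
              exact hv.2
            · intro v _ _
              exact hw0 v
        _ ≤ _ := by
            exact sum_biUnion_le' _ _ hw0
    have a2 : ε * ∑ x ∈ (f \ I).erase u, ∑ v ∈ K E I x, w v ≤ k * pm := by
      rw [mul_sum]
      calc _ ≤ ∑ x ∈ (f \ I).erase u, pm := sum_le_sum fun x hx => hp x (h x hx)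
        _ ≤ _ := by
          rw [sum_const, nsmul_eq_mul]
          apply mul_le_mul_of_nonneg_right _ hpm0
          rw [← hG.card f hf.1]
          exact_mod_cast card_le_card ((erase_subset _ _).trans sdiff_subset)
    have a3 := mul_le_mul_of_nonneg_left a1 hε
    have := mul_le_mul_of_nonneg_left (a3.trans a2) hn
    linarith
  · push Not at h
    obtain ⟨x, hx, hx0⟩ := h
    rw [prod_eq_zero hx (by simp [wp, hx0])]
    simp

lemma core (hG : Good E k) (hw0 : ∀ x, 0 ≤ w x) (hwI : ∀ x, x ∈ I → w x = 0) (hε : 0 ≤ ε)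
    (hpm0 : 0 ≤ pm) (hpm : pm ≤ 1 / 2)
    (hp : ∀ x, w x ≠ 0 → pk E I w ε x ≤ pm) (hQ : 0 ≤ Q) (hwQ : ∀ x, wp E I w ε x ≤ Q)
    (hθ : 0 ≤ θ) (hθQ : θ * (2 * Q ^ (j - 1)) ≤ 1) (hu : w u ≠ 0) :
    ∑ v ∈ univ.filter (fun v => v ∉ K E I u), ε * w v *
        (wp E I w ε u * Real.exp (θ * dg E (insert v I) (wn E I w ε v) j u)) +
      (1 - ε * ∑ v, w v) * (wp E I w ε u * Real.exp (θ * dg E I (wp E I w ε) j u)) ≤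
    w u * Real.exp (θ * dg E I w j u) * Real.exp (θ * (
      2 * (ε * j * dg E I (wp E I w ε) (j + 1) u) + ε * k ^ 2 * Q * dg E I (wp E I w ε) j u +
      2 * (θ * (2 * Q ^ (j - 1))) * (ε * j * dg E I (wp E I w ε) (j + 1) u +
        k * pm * dg E I (wp E I w ε) j u))) := by
  have huI : u ∉ I := fun h => hu (hwI u h)
  have hwp0 := wp_nonneg (E := E) (I := I) hw0 hpm hp
  have hlwp := le_wp (E := E) (I := I) hw0 hε hpm hp
  have hwQ' : ∀ x, w x ≤ Q := fun x => (hlwp x).trans (hwQ x)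
  have hpu := hp u hu
  have hpu0 := pk_nonneg (E := E) (I := I) hw0 hε u
  have hG1 := sum_gv_le (j := j) hw0 hlwp hwI huI
  have hL1 := sum_lv_le (j := j) (u := u) hG hw0 hε hpm0 hpm hp
  have hL2 := sum_pk_ge (j := j) (u := u) hG hw0 hε hpm hp hwQ'
  have hL3 := dg_wp_sub (j := j) (u := u) hw0 hε hpm hp
  have hwu := wp_mul hpm hp u
  set S := univ.filter (fun v => v ∉ K E I u) with hS
  set D := dg E I (wp E I w ε) j u with hD
  set D1 := dg E I (wp E I w ε) (j + 1) u with hD1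
  set d := dg E I w j u with hd
  set G := ε * ∑ v ∈ S, w v * gv E I (wp E I w ε) j u v with hGd
  set L := ε * ∑ v ∈ S, w v * lv E I (wp E I w ε) j u v with hLd
  set J := 2 * Q ^ (j - 1) with hJ
  have hJ0 : 0 ≤ J := by positivity
  have hD0 : 0 ≤ D := dg_nonneg hwp0
  have hD10 : 0 ≤ D1 := dg_nonneg hwp0
  have hG0 : 0 ≤ G := mul_nonneg hε (sum_nonneg fun v _ => mul_nonneg (hw0 v) (gv_nonneg hwp0))
  have hL0 : 0 ≤ L := mul_nonneg hε (sum_nonneg fun v _ => mul_nonneg (hw0 v) (lv_nonneg hwp0))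
  have hG2 : G ≤ ε * j * D1 := by
    rw [mul_assoc]; exact mul_le_mul_of_nonneg_left hG1 hε
  -- pointwise bound
  have hpt : ∀ v ∈ S, ε * w v *
        (wp E I w ε u * Real.exp (θ * dg E (insert v I) (wn E I w ε v) j u)) ≤
      wp E I w ε u * Real.exp (θ * D) * (ε * w v + θ * (ε * (w v * gv E I (wp E I w ε) j u v) -
        ε * (w v * lv E I (wp E I w ε) j u v)) + θ * (θ * J) * (ε * (w v * gv E I (wp E I w ε) j u v) +
        ε * (w v * lv E I (wp E I w ε) j u v))) := by
    intro v hv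
    by_cases hwv : w v = 0
    · simp [hwv]
    have hvI : v ∉ I := fun h => hwv (hwI v h)
    have hvK : v ∉ K E I u := by simpa [hS] using hv
    have huv : u ≠ v := by rintro rfl; exact hvK mem_K_self
    have s1 := dg_step (j := j) hwp0 hvI hvK
    have s2 := gv_le (j := j) hG hwp0 hQ hwQ huI hvI huv
    have s3 := lv_le (j := j) hG hwp0 hQ hwQ huI hvK
    have s4 : 0 ≤ gv E I (wp E I w ε) j u v := gv_nonneg hwp0
    have s5 : 0 ≤ lv E I (wp E I w ε) j u v := lv_nonneg hwp0
    set g := gv E I (wp E I w ε) j u v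
    set l := lv E I (wp E I w ε) j u v
    have hqq : 0 ≤ Q ^ (j - 1) := by positivity
    have habs : |g - l| ≤ J := by rw [abs_le]; constructor <;> linarith
    have hz : |θ * (g - l)| ≤ 1 := by
      rw [abs_mul, abs_of_nonneg hθ]
      exact (mul_le_mul_of_nonneg_left habs hθ).trans hθQ
    have hz2 : (θ * (g - l)) ^ 2 ≤ θ * (θ * J) * (g + l) := by
      have : (g - l) ^ 2 ≤ J * (g + l) := by
        rw [abs_le] at habs
        nlinarith
      have := mul_le_mul_of_nonneg_left this (mul_nonneg hθ hθ)
      nlinarith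
    have hexp := (abs_le.1 (Real.abs_exp_sub_one_sub_id_le hz)).2
    have h1 : Real.exp (θ * dg E (insert v I) (wn E I w ε v) j u) ≤
        Real.exp (θ * D) * Real.exp (θ * (g - l)) := by
      rw [← Real.exp_add]
      apply Real.exp_le_exp.2
      have := mul_le_mul_of_nonneg_left s1 hθ
      linarith
    have h2 : Real.exp (θ * dg E (insert v I) (wn E I w ε v) j u) ≤
        Real.exp (θ * D) * (1 + θ * (g - l) + θ * (θ * J) * (g + l)) := by
      refine h1.trans (mul_le_mul_of_nonneg_left ?_ (Real.exp_pos _).le)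
      linarith
    have h3 := mul_le_mul_of_nonneg_left h2 (mul_nonneg (mul_nonneg hε (hw0 v)) (hwp0 u))
    linarith
  have hsum := sum_le_sum hpt
  have hSw : ε * ∑ v ∈ S, w v = ε * ∑ v, w v - pk E I w ε u := by
    unfold pk
    rw [← mul_sub]
    congr 1
    rw [eq_sub_iff_add_eq, add_comm]
    have := sum_filter_add_sum_filter_not univ (fun v => v ∈ K E I u) w
    have e : univ.filter (fun v => v ∈ K E I u) = K E I u := by ext; simp
    rw [e] at this
    exact this
  rw [← mul_sum, sum_add_distrib, sum_add_distrib, ← mul_sum, ← mul_sum, ← mul_sum,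
    sum_sub_distrib, sum_add_distrib, ← mul_sum, ← mul_sum, hSw] at hsum
  have hA : ∑ v ∈ S, ε * w v *
        (wp E I w ε u * Real.exp (θ * dg E (insert v I) (wn E I w ε v) j u)) +
      (1 - ε * ∑ v, w v) * (wp E I w ε u * Real.exp (θ * D)) ≤
      wp E I w ε u * Real.exp (θ * D) * ((1 - pk E I w ε u) + θ * (G - L) + θ * (θ * J) * (G + L)) := by
    linarith
  refine hA.trans ?_
  have hB : wp E I w ε u * ((1 - pk E I w ε u) + θ * (G - L) + θ * (θ * J) * (G + L)) ≤
      w u * Real.exp (2 * (θ * G) - θ * L + 2 * (θ * (θ * J)) * (G + L)) := by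
    have q1 : (1 - pk E I w ε u) + θ * (G - L) + θ * (θ * J) * (G + L) ≤
        (1 - pk E I w ε u) * (1 + (2 * (θ * G) - θ * L + 2 * (θ * (θ * J)) * (G + L))) := by
      have t1 : 0 ≤ θ * G := by positivity
      have t2 : 0 ≤ θ * L := by positivity
      have t3 : 0 ≤ θ * (θ * J) * (G + L) := by positivity
      nlinarith [mul_nonneg t2 hpu0, mul_nonneg t1 (by linarith : 0 ≤ 1 - 2 * pk E I w ε u),
        mul_nonneg t3 (by linarith : 0 ≤ 1 - 2 * pk E I w ε u)]
    have q2 := mul_le_mul_of_nonneg_left q1 (hwp0 u)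
    have e1 : ∀ Y, wp E I w ε u * ((1 - pk E I w ε u) * Y) = w u * Y := fun Y => by
      rw [← mul_assoc, ← hwu]
    rw [e1] at q2
    refine q2.trans (mul_le_mul_of_nonneg_left ?_ (hw0 u))
    have := Real.add_one_le_exp (2 * (θ * G) - θ * L + 2 * (θ * (θ * J)) * (G + L))
    linarith
  calc _ = Real.exp (θ * D) * (wp E I w ε u * ((1 - pk E I w ε u) + θ * (G - L) + θ * (θ * J) * (G + L))) := by ring
    _ ≤ Real.exp (θ * D) * (w u * Real.exp (2 * (θ * G) - θ * L + 2 * (θ * (θ * J)) * (G + L))) :=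
        mul_le_mul_of_nonneg_left hB (Real.exp_pos _).le
    _ = w u * Real.exp (θ * D + (2 * (θ * G) - θ * L + 2 * (θ * (θ * J)) * (G + L))) := by
        rw [Real.exp_add (θ * D)]
        generalize Real.exp (2 * (θ * G) - θ * L + 2 * (θ * (θ * J)) * (G + L)) = Z
        ring
    _ ≤ _ := by
        rw [mul_assoc (w u), ← Real.exp_add]
        apply mul_le_mul_of_nonneg_left _ (hw0 u)
        apply Real.exp_le_exp.2
        have z1 : D - d ≤ L + ε * k ^ 2 * Q * D := hL3.trans hL2
        have z2 := mul_le_mul_of_nonneg_left z1 hθ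
        have z3 := mul_le_mul_of_nonneg_left hG2 hθ
        have z4 : G + L ≤ ε * j * D1 + k * pm * D := add_le_add hG2 hL1
        have z5 := mul_le_mul_of_nonneg_left z4 (mul_nonneg hθ (mul_nonneg hθ hJ0))
        linarith

end Uncrowded

set_option linter.unusedSectionVars false

namespace Uncrowded
open Finset
variable {V : Type*} [Fintype V] [DecidableEq V]
variable {E : Finset (Finset V)} {I : Finset V} {w : V → ℝ} {k j : ℕ} {u v : V} {ε Q pm θ t a b : ℝ}
  {m m' B R : ℕ → ℝ}

noncomputable def phi (E : Finset (Finset V)) (k : ℕ) (θ t b a : ℝ) (m : ℕ → ℝ) (I : Finset V)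
    (w : V → ℝ) (u : V) : ℝ :=
  a - b * ∑ j ∈ Icc 2 k, Real.exp (θ / t ^ (j - 1) * dg E I w j u - θ * m j)

noncomputable def Phi (E : Finset (Finset V)) (k : ℕ) (θ t b a : ℝ) (m : ℕ → ℝ) (I : Finset V)
    (w : V → ℝ) : ℝ :=
  I.card + ∑ u, w u * phi E k θ t b a m I w u

/-- Invariants without the degree bound. -/
structure Inv0 (E : Finset (Finset V)) (q : ℝ) (I : Finset V) (w : V → ℝ) : Prop where
  w0 : ∀ x, 0 ≤ w x
  wI : ∀ x, x ∈ I → w x = 0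
  ind : ∀ f ∈ E, ¬ f ⊆ I
  w1 : ∀ x, w x ≠ 0 → ∀ f ∈ E, f \ I ≠ {x}
  wQ : ∀ x, w x ≤ q

/-- Degree bound. -/
def DB (E : Finset (Finset V)) (k : ℕ) (t : ℝ) (B : ℕ → ℝ) (I : Finset V) (w : V → ℝ) : Prop :=
  ∀ u, w u ≠ 0 → ∀ j ∈ Icc 2 k, dg E I w j u ≤ B j * t ^ (j - 1)

lemma discard {q : ℝ} (ht : 0 < t) (hθ : 0 ≤ θ) (hb : 0 ≤ b) (h : Inv0 E q I w) (hq : 0 ≤ q)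
    (hB : ∀ j ∈ Icc 2 k, a ≤ b * Real.exp (θ * B j - θ * m j)) :
    ∃ w', Inv0 E q I w' ∧ DB E k t B I w' ∧ Phi E k θ t b a m I w ≤ Phi E k θ t b a m I w' := by
  classical
  let bad : V → Prop := fun u => ∃ j ∈ Icc 2 k, B j * t ^ (j - 1) < dg E I w j u
  let w' : V → ℝ := fun u => if bad u then 0 else w u
  have hle : ∀ x, w' x ≤ w x := fun x => by
    simp only [w']; split_ifs; exacts [h.w0 x, le_rfl]
  have hn : ∀ x, 0 ≤ w' x := fun x => by
    simp only [w']; split_ifs; exacts [le_rfl, h.w0 x]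
  have hne : ∀ x, w' x ≠ 0 → w x ≠ 0 ∧ ¬ bad x := fun x hx => by
    simp only [w'] at hx; split_ifs at hx with hc
    · exact absurd rfl hx
    · exact ⟨hx, hc⟩
  have hdg : ∀ j u, dg E I w' j u ≤ dg E I w j u := fun j u => dg_mono hn hle
  refine ⟨w', ⟨hn, ?_, h.ind, fun x hx => h.w1 x (hne x hx).1, fun x => (hle x).trans (h.wQ x)⟩, ?_, ?_⟩
  · intro x hx
    by_contra hc
    exact (hne x hc).1 (h.wI x hx)
  · intro u hu j hj
    have := (hne u hu).2
    simp only [bad, not_exists, not_and, not_lt] at this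
    exact (hdg j u).trans (this j hj)
  · unfold Phi
    apply add_le_add le_rfl
    apply sum_le_sum
    intro u _
    by_cases hu : bad u
    · have e : w' u = 0 := by simp [w', hu]
      rw [e, zero_mul]
      apply mul_nonpos_of_nonneg_of_nonpos (h.w0 u)
      obtain ⟨j, hj, hlt⟩ := hu
      unfold phi
      have h1 : Real.exp (θ * B j - θ * m j) ≤
          ∑ j ∈ Icc 2 k, Real.exp (θ / t ^ (j - 1) * dg E I w j u - θ * m j) := by
        refine le_trans ?_ (single_le_sum (fun i _ => (Real.exp_pos _).le) hj)
        apply Real.exp_le_exp.2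
        have : θ * B j ≤ θ / t ^ (j - 1) * dg E I w j u := by
          rw [div_mul_eq_mul_div, le_div_iff₀ (by positivity), mul_assoc]
          exact mul_le_mul_of_nonneg_left hlt.le hθ
        linarith
      have h2 := mul_le_mul_of_nonneg_left h1 hb
      have := hB j hj
      linarith
    · have e : w' u = w u := by simp [w', hu]
      rw [e]
      apply mul_le_mul_of_nonneg_left _ (h.w0 u)
      unfold phi
      apply sub_le_sub_left
      apply mul_le_mul_of_nonneg_left _ hb
      apply sum_le_sum
      intro j _
      apply Real.exp_le_exp.2
      apply sub_le_sub_right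
      apply mul_le_mul_of_nonneg_left (hdg j u)
      positivity

lemma inv_wp {q : ℝ} (h : Inv0 E q I w) (hε : 0 ≤ ε) (hpm0 : 0 ≤ pm) (hpm : pm ≤ 1 / 2)
    (hp : ∀ x, w x ≠ 0 → pk E I w ε x ≤ pm) :
    Inv0 E ((1 + 2 * pm) * q) I (wp E I w ε) where
  w0 := wp_nonneg h.w0 hpm hp
  wI x hx := by simp [wp, h.wI x hx]
  ind := h.ind
  w1 x hx := h.w1 x (fun h => hx (by simp [wp, h]))
  wQ x := (wp_le h.w0 hε hpm hp x).trans (mul_le_mul_of_nonneg_left (h.wQ x) (by linarith))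

lemma inv_wn {q : ℝ} (h : Inv0 E q I w) (hε : 0 ≤ ε) (hpm0 : 0 ≤ pm) (hpm : pm ≤ 1 / 2)
    (hp : ∀ x, w x ≠ 0 → pk E I w ε x ≤ pm) (hv : w v ≠ 0) :
    Inv0 E ((1 + 2 * pm) * q) (insert v I) (wn E I w ε v) := by
  have H := inv_wp h hε hpm0 hpm hp
  refine ⟨?_, ?_, ?_, ?_, ?_⟩
  · intro x; unfold wn; split_ifs; exacts [le_rfl, H.w0 x]
  · intro x hx
    unfold wn
    split_ifs with hc
    · rfl
    rcases mem_insert.1 hx with rfl | hx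
    · exact absurd mem_K_self hc
    · exact H.wI x hx
  · intro f hf hfI
    by_cases hvf : v ∈ f
    · apply h.w1 v hv f hf
      have hvI : v ∉ I := fun hh => hv (h.wI v hh)
      ext y
      simp only [mem_sdiff, mem_singleton]
      constructor
      · rintro ⟨hy, hyI⟩
        rcases mem_insert.1 (hfI hy) with hh | hh
        · exact hh
        · exact absurd hh hyI
      · rintro rfl
        exact ⟨hvf, hvI⟩
    · apply h.ind f hf
      intro y hy
      rcases mem_insert.1 (hfI hy) with rfl | hh
      · exact absurd hy hvf
      · exact hh
  · intro x hx f hf hfx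
    unfold wn at hx
    split_ifs at hx with hc
    · exact hx rfl
    have hwx : w x ≠ 0 := fun h => hx (by simp [wp, h])
    have hxf : x ∈ f ∧ x ∉ insert v I := by
      rw [← mem_sdiff, hfx]; exact mem_singleton_self x
    by_cases hvf : v ∈ f
    · apply hc
      rw [mem_K]
      right
      refine ⟨f, hf, ?_⟩
      have hvI : v ∉ I := fun hh => hv (h.wI v hh)
      ext y
      simp only [mem_insert, mem_singleton, mem_sdiff]
      constructor
      · rintro ⟨hy, hyI⟩
        by_cases hyv : y = v
        · exact Or.inr hyv
        · left
          rw [← mem_singleton, ← hfx, mem_sdiff, mem_insert]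
          tauto
      · rintro (rfl | rfl)
        · exact ⟨hxf.1, fun hh => hxf.2 (mem_insert_of_mem hh)⟩
        · exact ⟨hvf, hvI⟩
    · apply h.w1 x hwx f hf
      rw [← hfx]
      ext y
      simp only [mem_insert, mem_sdiff]
      constructor
      · rintro ⟨hy, hyI⟩
        refine ⟨hy, ?_⟩
        rintro (rfl | hh)
        · exact hvf hy
        · exact hyI hh
      · rintro ⟨hy, hyI⟩
        exact ⟨hy, fun hh => hyI (Or.inr hh)⟩
  · intro x
    unfold wn
    split_ifs
    · exact (H.w0 x).trans (H.wQ x)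
    · exact H.wQ x

lemma pk_le {q : ℝ} (hG : Good E k) (hk : 2 ≤ k) (ht : 0 < t) (h : Inv0 E q I w) (hD : DB E k t B I w)
    (hε : 0 ≤ ε) (hq : q ≤ t * B 2) (x : V) (hx : w x ≠ 0) :
    pk E I w ε x ≤ 2 * ε * t * B 2 := by
  have h2 := hD x hx 2 (by simp [hk])
  have hxI : x ∉ I := fun hh => hx (h.wI x hh)
  unfold pk
  have key : ∑ v ∈ K E I x, w v ≤ w x + dg E I w 2 x := by
    rw [← add_sum_erase _ _ (mem_K_self (E := E) (I := I) (u := x))]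
    apply add_le_add le_rfl
    unfold dg
    have : ∀ v ∈ (K E I x).erase x, ∃ f ∈ E, f \ I = {x, v} := by
      intro v hv
      rw [mem_erase, mem_K] at hv
      tauto
    choose! F hF using this
    calc ∑ v ∈ (K E I x).erase x, w v = ∑ v ∈ (K E I x).erase x, ∏ y ∈ (F v \ I).erase x, w y := by
          apply sum_congr rfl
          intro v hv
          rw [(hF v hv).2, erase_insert, prod_singleton]
          rw [mem_singleton]; exact fun hh => (mem_erase.1 hv).1 hh.symm
      _ = ∑ f ∈ ((K E I x).erase x).image F, ∏ y ∈ (f \ I).erase x, w y := by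
          rw [sum_image]
          intro v hv v' hv' e
          have h1 := (hF v hv).2
          rw [e, (hF v' hv').2] at h1
          have : v' ∈ ({x, v} : Finset V) := by rw [← h1]; simp
          simp only [mem_insert, mem_singleton] at this
          rcases this with hh | hh
          · exact absurd hh (mem_erase.1 hv').1
          · exact hh.symm
      _ ≤ _ := by
          apply sum_le_sum_of_subset_of_nonneg
          · intro f hf
            obtain ⟨v, hv, rfl⟩ := mem_image.1 hf
            rw [mem_filter]
            have hh := hF v hv
            refine ⟨hh.1, ?_, ?_⟩
            · have : x ∈ F v \ I := by rw [hh.2]; simp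
              exact (mem_sdiff.1 this).1
            · rw [hh.2, card_pair]
              exact fun h => (mem_erase.1 hv).1 h.symm
          · intro f _ _
            exact prod_nonneg fun _ _ => h.w0 _
  have h3 := h.wQ x
  simp only [Nat.add_one_sub_one, pow_one] at h2
  have := mul_le_mul_of_nonneg_left key hε
  have h4 : w x + dg E I w 2 x ≤ 2 * (t * B 2) := by norm_num at h2; linarith
  have := mul_le_mul_of_nonneg_left h4 hε
  linarith

end Uncrowded

set_option linter.unusedSectionVars false

namespace Uncrowded
open Finset
variable {V : Type*} [Fintype V] [DecidableEq V]
variable {E : Finset (Finset V)} {I : Finset V} {w : V → ℝ} {k j : ℕ} {u v : V} {ε Q pm θ t a b : ℝ}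
  {m m' B R : ℕ → ℝ}

/-- Parameter conditions. -/
structure Par (k : ℕ) (ε θ t Q : ℝ) (B R : ℕ → ℝ) : Prop where
  k2 : 2 ≤ k
  t0 : 0 < t
  ε0 : 0 ≤ ε
  θ0 : 0 ≤ θ
  Q0 : 0 ≤ Q
  B0 : ∀ j, 0 ≤ B j
  QB : Q ≤ t * B 2
  pm1 : 2 * ε * t * B 2 ≤ 1 / 2
  pm2 : (1 + 2 * (2 * ε * t * B 2)) ^ k ≤ 2
  θQ : ∀ j ∈ Icc 2 k, 2 * θ * (Q / t) ^ (j - 1) ≤ 1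
  hR : ∀ j ∈ Icc 2 k, 4 * k * B (j + 1) + 2 * k ^ 2 * Q * B j / t +
    2 * (2 * θ * (Q / t) ^ (j - 1)) * (2 * k * B (j + 1) + 4 * k * B 2 * B j) ≤ R j

lemma dg_big (hG : Good E k) (hj : k < j) : dg E I w j u = 0 := by
  unfold dg
  rw [filter_false_of_mem, sum_empty]
  rintro f hf ⟨_, h⟩
  have := card_le_card (sdiff_subset (s := f) (t := I))
  rw [hG.card f hf] at this
  omega

lemma core2 {q : ℝ} (hG : Good E k) (P : Par k ε θ t Q B R) (h : Inv0 E q I w) (hD : DB E k t B I w)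
    (hqQ : (1 + 2 * (2 * ε * t * B 2)) * q ≤ Q) (hq0 : 0 ≤ q) (hj : j ∈ Icc 2 k) (hu : w u ≠ 0) :
    ∑ v ∈ univ.filter (fun v => v ∉ K E I u), ε * w v *
        (wp E I w ε u * Real.exp (θ / t ^ (j - 1) * dg E (insert v I) (wn E I w ε v) j u -
          θ * (m j + ε * t * R j))) +
      (1 - ε * ∑ v, w v) * (wp E I w ε u * Real.exp (θ / t ^ (j - 1) * dg E I (wp E I w ε) j u -
        θ * (m j + ε * t * R j))) ≤
    w u * Real.exp (θ / t ^ (j - 1) * dg E I w j u - θ * m j) := by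
  have ht := P.t0
  have hε := P.ε0
  have hθ := P.θ0
  have hQ := P.Q0
  have hB2 := P.B0 2
  have hpm0 : 0 ≤ 2 * ε * t * B 2 := by positivity
  have hqQ' : q ≤ Q := by nlinarith
  have hp := pk_le hG P.k2 ht h hD hε (hqQ'.trans P.QB)
  have H := inv_wp h hε hpm0 P.pm1 hp
  have hjk := mem_Icc.1 hj
  have hθQ : θ / t ^ (j - 1) * (2 * Q ^ (j - 1)) = 2 * θ * (Q / t) ^ (j - 1) := by
    rw [div_pow]; ring
  have hth : 0 ≤ θ / t ^ (j - 1) := by positivity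
  have hc := core hG h.w0 h.wI hε hpm0 P.pm1 hp hQ (fun x => (H.wQ x).trans hqQ) hth
    (by rw [hθQ]; exact P.θQ j hj) hu
  have hDj : dg E I (wp E I w ε) j u ≤ 2 * (B j * t ^ (j - 1)) :=
    (dg_wp_le hG h.w0 hε hpm0 P.pm1 P.pm2 hp).trans
      (mul_le_mul_of_nonneg_left (hD u hu j hj) (by norm_num))
  have hDj1 : dg E I (wp E I w ε) (j + 1) u ≤ 2 * (B (j + 1) * t ^ j) := by
    rcases eq_or_lt_of_le hjk.2 with hh | hh
    · rw [dg_big hG (by omega)]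
      have := P.B0 (j + 1)
      positivity
    · refine (dg_wp_le hG h.w0 hε hpm0 P.pm1 P.pm2 hp).trans
        (mul_le_mul_of_nonneg_left (hD u hu (j + 1) (mem_Icc.2 ⟨by omega, hh⟩)) (by norm_num))
  have hD0 : 0 ≤ dg E I (wp E I w ε) j u := dg_nonneg H.w0
  have hD10 : 0 ≤ dg E I (wp E I w ε) (j + 1) u := dg_nonneg H.w0
  have hR := P.hR j hj
  rw [hθQ] at hc
  set D := dg E I (wp E I w ε) j u
  set D1 := dg E I (wp E I w ε) (j + 1) u
  set Y := 2 * θ * (Q / t) ^ (j - 1) with hY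
  have hY0 : 0 ≤ Y := by positivity
  have hBj := P.B0 j
  have hBj1 := P.B0 (j + 1)
  have htj : t ^ j = t ^ (j - 1) * t := by rw [← pow_succ]; congr 1; omega
  have herr : θ / t ^ (j - 1) * (2 * (ε * j * D1) + ε * k ^ 2 * Q * D +
      2 * Y * (ε * j * D1 + k * (2 * ε * t * B 2) * D)) ≤ θ * (ε * t * R j) := by
    have hjk' : (j : ℝ) ≤ k := by exact_mod_cast hjk.2
    calc _ ≤ θ / t ^ (j - 1) * (2 * (ε * k * (2 * (B (j + 1) * t ^ j))) +
          ε * k ^ 2 * Q * (2 * (B j * t ^ (j - 1))) +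
          2 * Y * (ε * k * (2 * (B (j + 1) * t ^ j)) +
            k * (2 * ε * t * B 2) * (2 * (B j * t ^ (j - 1))))) := by gcongr
      _ = θ * (ε * t * (4 * k * B (j + 1) + 2 * k ^ 2 * Q * B j / t +
            2 * Y * (2 * k * B (j + 1) + 4 * k * B 2 * B j))) := by
          rw [htj]; field_simp; ring
      _ ≤ _ := by gcongr
  have hexp : ∀ x, Real.exp (x - θ * (m j + ε * t * R j)) =
      Real.exp x * Real.exp (- (θ * (m j + ε * t * R j))) := fun x => by
    rw [← Real.exp_add]; rfl
  simp only [hexp, ← mul_assoc]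
  rw [← sum_mul, ← add_mul]
  simp only [mul_assoc]
  simp only [mul_assoc] at hc
  refine (mul_le_mul_of_nonneg_right hc (Real.exp_pos _).le).trans ?_
  rw [mul_assoc (w u), ]
  apply mul_le_mul_of_nonneg_left _ (h.w0 u)
  rw [← Real.exp_add, ← Real.exp_add]
  apply Real.exp_le_exp.2
  simp only [mul_assoc] at herr
  linarith

lemma step {q a' : ℝ} (hG : Good E k) (P : Par k ε θ t Q B R) (h : Inv0 E q I w) (hD : DB E k t B I w)
    (hqQ : (1 + 2 * (2 * ε * t * B 2)) * q ≤ Q) (hq0 : 0 ≤ q) (hb : 0 ≤ b)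
    (hN : ε * ((Fintype.card V : ℝ) * Q) < 1)
    (hB : ∀ j ∈ Icc 2 k, a' ≤ b * Real.exp (θ * B j - θ * (m j + ε * t * R j))) :
    ∃ I' w', Inv0 E ((1 + 2 * (2 * ε * t * B 2)) * q) I' w' ∧ DB E k t B I' w' ∧
      Phi E k θ t b (a' + ε) m I w ≤ Phi E k θ t b a' (fun j => m j + ε * t * R j) I' w' := by
  have ht := P.t0
  have hε := P.ε0
  have hθ := P.θ0
  have hQ := P.Q0
  have hB2 := P.B0 2
  have hpm0 : 0 ≤ 2 * ε * t * B 2 := by positivity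
  have hqQ' : q ≤ Q := by nlinarith
  have hp := pk_le hG P.k2 ht h hD hε (hqQ'.trans P.QB)
  have H := inv_wp h hε hpm0 P.pm1 hp
  set M : ℕ → ℝ := fun j => m j + ε * t * R j with hM
  have hsum : ε * ∑ v, w v < 1 := by
    refine lt_of_le_of_lt (mul_le_mul_of_nonneg_left ?_ hε) hN
    calc ∑ v, w v ≤ ∑ v : V, Q := sum_le_sum fun v _ => (h.wQ v).trans hqQ'
      _ = _ := by simp
  have main : Phi E k θ t b (a' + ε) m I w ≤
      ∑ v, ε * w v * Phi E k θ t b a' M (insert v I) (wn E I w ε v) +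
        (1 - ε * ∑ v, w v) * Phi E k θ t b a' M I (wp E I w ε) := by
    unfold Phi
    have e1 : ∀ v, ε * w v * (((insert v I).card : ℝ) + ∑ u, wn E I w ε v u *
        phi E k θ t b a' M (insert v I) (wn E I w ε v) u) =
        (I.card + 1) * (ε * w v) + ∑ u, ε * w v * (wn E I w ε v u *
        phi E k θ t b a' M (insert v I) (wn E I w ε v) u) := by
      intro v
      rw [mul_add, mul_sum]
      by_cases hv : w v = 0
      · simp [hv]
      · rw [card_insert_of_notMem (fun hh => hv (h.wI v hh))]
        push_cast; ring
    simp only [e1]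
    have tot : ∀ F : V → V → ℝ, ∑ v, ((I.card + 1) * (ε * w v) + ∑ u, F v u) =
        (I.card + 1) * (ε * ∑ v, w v) + ∑ u, ∑ v, F v u := by
      intro F
      rw [sum_add_distrib, mul_sum, mul_sum, sum_comm]
    rw [tot, mul_add, mul_sum (univ : Finset V) _ (1 - ε * ∑ v, w v)]
    have key : ∀ u, w u * phi E k θ t b (a' + ε) m I w u ≤ ε * w u + (∑ v, ε * w v * (wn E I w ε v u *
        phi E k θ t b a' M (insert v I) (wn E I w ε v) u) +
        (1 - ε * ∑ v, w v) * (wp E I w ε u * phi E k θ t b a' M I (wp E I w ε) u)) := by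
      intro u
      by_cases hu : w u = 0
      · simp [hu, wn, wp]
      have f1 : ∑ v, ε * w v * (wn E I w ε v u *
          phi E k θ t b a' M (insert v I) (wn E I w ε v) u) =
          ∑ v ∈ univ.filter (fun v => v ∉ K E I u), ε * w v * (wp E I w ε u *
          phi E k θ t b a' M (insert v I) (wn E I w ε v) u) := by
        rw [sum_filter]
        apply sum_congr rfl
        intro v _
        unfold wn
        split_ifs <;> simp_all
      rw [f1]
      unfold phi
      have f2 : ∀ j ∈ Icc 2 k, _ := fun j hj => core2 (m := m) hG P h hD hqQ hq0 hj hu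
      have f3 := mul_le_mul_of_nonneg_left (sum_le_sum f2) hb
      have hSw : ε * ∑ v ∈ univ.filter (fun v => v ∉ K E I u), w v = ε * ∑ v, w v - pk E I w ε u := by
        unfold pk
        rw [← mul_sub]
        congr 1
        rw [eq_sub_iff_add_eq, add_comm]
        have := sum_filter_add_sum_filter_not univ (fun v => v ∈ K E I u) w
        have e : univ.filter (fun v => v ∈ K E I u) = K E I u := by ext; simp
        rw [e] at this
        exact this
      have hwu := wp_mul P.pm1 hp u
      have g1 : ∀ v, ε * w v * (wp E I w ε u * (a' - b * ∑ j ∈ Icc 2 k,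
          Real.exp (θ / t ^ (j - 1) * dg E (insert v I) (wn E I w ε v) j u - θ * M j))) =
          a' * wp E I w ε u * (ε * w v) - b * ∑ j ∈ Icc 2 k, ε * w v * (wp E I w ε u *
          Real.exp (θ / t ^ (j - 1) * dg E (insert v I) (wn E I w ε v) j u - θ * M j)) := by
        intro v
        rw [← mul_sum, ← mul_sum]; ring
      have g2 : (1 - ε * ∑ v, w v) * (wp E I w ε u * (a' - b * ∑ j ∈ Icc 2 k,
          Real.exp (θ / t ^ (j - 1) * dg E I (wp E I w ε) j u - θ * M j))) =
          a' * wp E I w ε u * (1 - ε * ∑ v, w v) - b * ∑ j ∈ Icc 2 k, (1 - ε * ∑ v, w v) *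
          (wp E I w ε u *
          Real.exp (θ / t ^ (j - 1) * dg E I (wp E I w ε) j u - θ * M j)) := by
        rw [← mul_sum, ← mul_sum]; ring
      have g3 : w u * (a' + ε - b * ∑ j ∈ Icc 2 k,
          Real.exp (θ / t ^ (j - 1) * dg E I w j u - θ * m j)) =
          a' * w u + ε * w u - b * ∑ j ∈ Icc 2 k, w u *
          Real.exp (θ / t ^ (j - 1) * dg E I w j u - θ * m j) := by
        rw [← mul_sum]; ring
      rw [g2, g3]
      simp only [g1]
      have g5 : ∀ F : V → ℕ → ℝ, ∑ v ∈ univ.filter (fun v => v ∉ K E I u),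
          (a' * wp E I w ε u * (ε * w v) - b * ∑ j ∈ Icc 2 k, F v j) =
          a' * wp E I w ε u * (ε * ∑ v, w v - pk E I w ε u) -
            b * ∑ j ∈ Icc 2 k, ∑ v ∈ univ.filter (fun v => v ∉ K E I u), F v j := by
        intro F
        rw [← hSw, sum_comm, mul_sum, mul_sum, mul_sum, sum_sub_distrib]
      rw [g5]
      rw [sum_add_distrib, mul_add] at f3
      have g4 : a' * wp E I w ε u * (ε * ∑ v, w v - pk E I w ε u) +
          a' * wp E I w ε u * (1 - ε * ∑ v, w v) = a' * w u := by
        conv_rhs => rw [hwu]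
        ring
      linarith
    have := sum_le_sum fun u (_ : u ∈ (univ : Finset V)) => key u
    rw [sum_add_distrib, sum_add_distrib, ← mul_sum] at this
    linarith
  have ex : (∃ v, w v ≠ 0 ∧ Phi E k θ t b (a' + ε) m I w ≤
      Phi E k θ t b a' M (insert v I) (wn E I w ε v)) ∨
      Phi E k θ t b (a' + ε) m I w ≤ Phi E k θ t b a' M I (wp E I w ε) := by
    by_contra hcon
    push Not at hcon
    obtain ⟨c1, c2⟩ := hcon
    have c3 : ∑ v, ε * w v * Phi E k θ t b a' M (insert v I) (wn E I w ε v) ≤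
        ∑ v, ε * w v * Phi E k θ t b (a' + ε) m I w := by
      apply sum_le_sum
      intro v _
      by_cases hv : w v = 0
      · simp [hv]
      · exact mul_le_mul_of_nonneg_left (c1 v hv).le (mul_nonneg hε (h.w0 v))
    rw [← sum_mul, ← mul_sum] at c3
    have c4 := mul_lt_mul_of_pos_left c2 (by linarith : 0 < 1 - ε * ∑ v, w v)
    linarith
  have hq' : 0 ≤ (1 + 2 * (2 * ε * t * B 2)) * q := by positivity
  rcases ex with ⟨v, hv, hle⟩ | hle
  · obtain ⟨w', h1, h2, h3⟩ := discard ht hθ hb (inv_wn h hε hpm0 P.pm1 hp hv) hq' hB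
    exact ⟨_, w', h1, h2, hle.trans h3⟩
  · obtain ⟨w', h1, h2, h3⟩ := discard ht hθ hb H hq' hB
    exact ⟨_, w', h1, h2, hle.trans h3⟩

end Uncrowded

set_option linter.unusedSectionVars false

namespace Uncrowded
open Finset
variable {V : Type*} [Fintype V] [DecidableEq V]
variable {E : Finset (Finset V)} {I : Finset V} {w : V → ℝ} {k j : ℕ} {u v : V} {ε Q pm θ t a b : ℝ}
  {m m' B R : ℕ → ℝ}

lemma dg_start (hG : Good E k) (hdeg : ∀ u, ((E.filter (fun f => u ∈ f)).card : ℝ) ≤ t ^ (k - 1))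
    (ht : 0 < t) (j : ℕ) (u : V) : dg E ∅ (fun _ => 1) j u ≤ t ^ (j - 1) := by
  unfold dg
  simp only [sdiff_empty, prod_const_one, sum_const, nsmul_eq_mul, mul_one]
  by_cases hj : j = k
  · subst hj
    refine le_trans ?_ (hdeg u)
    norm_cast
    apply card_le_card
    intro f hf
    simp only [mem_filter] at hf ⊢
    exact ⟨hf.1, hf.2.1⟩
  · rw [filter_false_of_mem]
    · simp only [card_empty, Nat.cast_zero]; positivity
    · rintro f hf ⟨_, h⟩
      exact hj (h.symm.trans (hG.card f hf))

lemma run (hG : Good E k) {T : ℕ} (P : Par k ε k t Q B R)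
    (hT : (1 + 2 * (2 * ε * t * B 2)) ^ T ≤ Q)
    (hN : ε * ((Fintype.card V : ℝ) * Q) < 1)
    (hR0 : ∀ j, 0 ≤ R j)
    (hBR : ∀ j ∈ Icc 2 k, 3 + T * ε * t * R j ≤ B j)
    (hdeg : ∀ u, ((E.filter (fun f => u ∈ f)).card : ℝ) ≤ t ^ (k - 1)) :
    ∃ I : Finset V, (∀ f ∈ E, ¬ f ⊆ I) ∧ (Fintype.card V : ℝ) * (T * ε) / 2 ≤ I.card := by
  have ht := P.t0
  have hε := P.ε0
  have hB2 := P.B0 2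
  have hk := P.k2
  set a0 : ℝ := T * ε with ha0
  have ha00 : 0 ≤ a0 := by positivity
  set b : ℝ := a0 * Real.exp (-(k : ℝ)) with hb
  have hb0 : 0 ≤ b := mul_nonneg ha00 (Real.exp_pos _).le
  set m : ℕ → ℕ → ℝ := fun s j => 2 + s * ε * t * R j with hm
  have hq1 : 1 ≤ 1 + 2 * (2 * ε * t * B 2) := by
    have : 0 ≤ 2 * (2 * ε * t * B 2) := by positivity
    linarith
  have ind : ∀ s, s ≤ T → ∃ I w, Inv0 E ((1 + 2 * (2 * ε * t * B 2)) ^ s) I w ∧ DB E k t B I w ∧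
      Phi E k k t b a0 (m 0) ∅ (fun _ => 1) ≤ Phi E k k t b (a0 - s * ε) (m s) I w := by
    intro s
    induction s with
    | zero =>
      intro _
      refine ⟨∅, fun _ => 1, ⟨fun _ => zero_le_one, by simp, ?_, ?_, by simp⟩, ?_, by simp⟩
      · intro f hf h
        have := hG.card f hf
        rw [subset_empty.1 h] at this
        simp at this; omega
      · intro x _ f hf h
        have := hG.card f hf
        rw [sdiff_empty] at h
        rw [h] at this
        simp at this; omega
      · intro u _ j hj
        refine (dg_start hG hdeg ht j u).trans ?_
        have h1 := hBR j hj
        have h2 := hR0 j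
        have : 1 ≤ B j := by
          have : 0 ≤ T * ε * t * R j := by positivity
          linarith
        exact le_mul_of_one_le_left (by positivity) this
    | succ s ih =>
      intro hs
      obtain ⟨I, w, h1, h2, h3⟩ := ih (by omega)
      have hstep := step (a' := a0 - (s + 1 : ℕ) * ε) (m := m s) (b := b) hG P h1 h2
        (by
          rw [← pow_succ']
          exact (pow_le_pow_right₀ hq1 hs).trans hT) (by positivity) hb0 hN
        (by
          intro j hj
          have hc : Real.exp k ≤ Real.exp (k * B j - k * (m s j + ε * t * R j)) := by
            apply Real.exp_le_exp.2
            have e1 := hBR j hj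
            have e2 : ((s + 1 : ℕ) : ℝ) * (ε * t * R j) ≤ T * (ε * t * R j) := by
              apply mul_le_mul_of_nonneg_right
              · exact_mod_cast hs
              · have := hR0 j; positivity
            push_cast at e2
            have e3 : 1 ≤ B j - (m s j + ε * t * R j) := by
              simp only [hm]; linarith
            have := mul_le_mul_of_nonneg_left e3 (Nat.cast_nonneg (α := ℝ) k)
            linarith
          have := mul_le_mul_of_nonneg_left hc hb0
          refine le_trans ?_ this
          rw [hb, mul_assoc, ← Real.exp_add]
          simp only [neg_add_cancel, Real.exp_zero, mul_one]
          have : 0 ≤ ((s + 1 : ℕ) : ℝ) * ε := by positivity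
          linarith)
      obtain ⟨I', w', g1, g2, g3⟩ := hstep
      refine ⟨I', w', ?_, g2, h3.trans ?_⟩
      · rw [pow_succ']; exact g1
      · have e1 : a0 - ((s + 1 : ℕ) : ℝ) * ε + ε = a0 - s * ε := by push_cast; ring
        have e2 : (fun j => m s j + ε * t * R j) = m (s + 1) := by
          funext j; simp only [hm]; push_cast; ring
        rw [e1, e2] at g3
        exact g3
  obtain ⟨I, w, h1, h2, h3⟩ := ind T le_rfl
  refine ⟨I, h1.ind, ?_⟩
  have hup : Phi E k k t b (a0 - T * ε) (m T) I w ≤ I.card := by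
    unfold Phi
    have : ∑ u, w u * phi E k k t b (a0 - T * ε) (m T) I w u ≤ 0 := by
      apply sum_nonpos
      intro u _
      apply mul_nonpos_of_nonneg_of_nonpos (h1.w0 u)
      unfold phi
      have : 0 ≤ b * ∑ j ∈ Icc 2 k, Real.exp (k / t ^ (j - 1) * dg E I w j u - k * m T j) :=
        mul_nonneg hb0 (sum_nonneg fun _ _ => (Real.exp_pos _).le)
      linarith
    linarith
  refine le_trans ?_ (h3.trans hup)
  unfold Phi
  have hpt : ∀ u, a0 / 2 ≤ 1 * phi E k k t b a0 (m 0) ∅ (fun _ => 1) u := by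
    intro u
    rw [one_mul]
    unfold phi
    have s1 : ∑ j ∈ Icc 2 k, Real.exp (k / t ^ (j - 1) * dg E ∅ (fun _ => 1) j u - k * m 0 j) ≤
        ∑ j ∈ Icc 2 k, Real.exp (-(k : ℝ)) := by
      apply sum_le_sum
      intro j hj
      apply Real.exp_le_exp.2
      have := dg_start hG hdeg ht j u
      have h4 : k / t ^ (j - 1) * dg E ∅ (fun _ => 1) j u ≤ k := by
        rw [div_mul_eq_mul_div, div_le_iff₀ (by positivity)]
        exact mul_le_mul_of_nonneg_left this (Nat.cast_nonneg _)
      simp only [hm]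
      push_cast
      linarith
    rw [sum_const, nsmul_eq_mul, Nat.card_Icc] at s1
    have s2 : ((k + 1 - 2 : ℕ) : ℝ) * Real.exp (-(k : ℝ)) ≤ k * Real.exp (-(k : ℝ)) := by
      apply mul_le_mul_of_nonneg_right _ (Real.exp_pos _).le
      exact_mod_cast (by omega : k + 1 - 2 ≤ k)
    have s3 := mul_le_mul_of_nonneg_left (s1.trans s2) hb0
    have s4 : Real.exp (-(k : ℝ)) * (k * Real.exp (-(k : ℝ))) ≤ 1 / 2 := by
      have : Real.exp (-(k : ℝ)) * (k * Real.exp (-(k : ℝ))) = k * Real.exp (-(2 * k : ℝ)) := by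
        rw [show -(2 * k : ℝ) = -(k : ℝ) + -k by ring, Real.exp_add]; ring
      rw [this, Real.exp_neg, ← div_eq_mul_inv, div_le_iff₀ (Real.exp_pos _)]
      have := Real.add_one_le_exp (2 * k : ℝ)
      linarith
    have s5 := mul_le_mul_of_nonneg_left s4 ha00
    have e : b * (k * Real.exp (-(k : ℝ))) = a0 * (Real.exp (-(k : ℝ)) * (k * Real.exp (-(k : ℝ)))) := by
      rw [hb]; ring
    linarith
  have := sum_le_sum fun u (_ : u ∈ (univ : Finset V)) => hpt u
  rw [sum_const, nsmul_eq_mul, card_univ] at this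
  simp only [card_empty, Nat.cast_zero, zero_add]
  linarith

noncomputable def BB (k : ℕ) (X : ℝ) (j : ℕ) : ℝ := if j ≤ k then 4 * (8 * k * X) ^ (k - j) else 0

set_option maxHeartbeats 1000000 in
lemma run2 (hG : Good E k) {X : ℝ} (hk : 2 ≤ k) (hX : 1 ≤ X)
    (ht : 26 * (k : ℝ) ^ 2 * Real.exp (8 * X * (4 * (8 * k * X) ^ (k - 2))) ≤ t)
    (hdeg : ∀ u, ((E.filter (fun f => u ∈ f)).card : ℝ) ≤ t ^ (k - 1)) :
    ∃ I : Finset V, (∀ f ∈ E, ¬ f ⊆ I) ∧ (Fintype.card V : ℝ) * (X / t) / 2 ≤ I.card := by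
  have hk' : (2 : ℝ) ≤ k := by exact_mod_cast hk
  set B := BB k X with hB
  have hX0 : 0 < X := by linarith
  have hY : 1 ≤ 8 * k * X := by nlinarith
  have hB0 : ∀ j, 0 ≤ B j := by
    intro j; simp only [hB, BB]; split_ifs <;> positivity
  have hB2 : B 2 = 4 * (8 * k * X) ^ (k - 2) := by simp [hB, BB, hk]
  have hB4 : 4 ≤ B 2 := by
    rw [hB2]; have := one_le_pow₀ hY (n := k - 2); linarith
  have hBle : ∀ j, 2 ≤ j → B j ≤ B 2 := by
    intro j hj
    rw [hB2]
    simp only [hB, BB]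
    split_ifs
    · have := pow_le_pow_right₀ hY (by omega : k - j ≤ k - 2); linarith
    · positivity
  set Q := Real.exp (4 * X * B 2) with hQ
  rw [← hB2] at ht
  have hQ2 : Real.exp (8 * X * B 2) = Q ^ 2 := by
    rw [hQ, ← Real.exp_nat_mul]; congr 1; push_cast; ring
  rw [hQ2] at ht
  have hQpos : 0 < Q := Real.exp_pos _
  have hXB : X * B 2 ^ 2 ≤ Q := by
    have h1 := Real.quadratic_le_exp_of_nonneg (x := 4 * X * B 2) (by positivity)
    have h2 : X * B 2 ^ 2 ≤ X ^ 2 * B 2 ^ 2 := by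
      apply mul_le_mul_of_nonneg_right _ (by positivity); nlinarith
    have h3 : 0 ≤ 4 * X * B 2 := by positivity
    have h4 : 0 ≤ X ^ 2 * B 2 ^ 2 := by positivity
    have h5 : (4 * X * B 2) ^ 2 / 2 = 8 * (X ^ 2 * B 2 ^ 2) := by ring
    linarith
  have hQ1 : 1 ≤ Q := by rw [hQ]; exact Real.one_le_exp (by positivity)
  have ht0 : 0 < t := lt_of_lt_of_le (by positivity) ht
  have hkey : 26 * (k : ℝ) ^ 2 * Q * (Q / t) ≤ 1 := by
    rw [mul_div_assoc', div_le_one ht0]; linarith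
  have hQt : Q / t ≤ 1 := by
    rw [div_le_one ht0]
    refine le_trans ?_ ht
    have : 1 ≤ 26 * (k : ℝ) ^ 2 * Q := by nlinarith [one_le_mul_of_one_le_of_one_le hQ1 hQ1]
    nlinarith
  have hQt0 : 0 < Q / t := by positivity
  have hpw : ∀ j ∈ Icc 2 k, (Q / t) ^ (j - 1) ≤ Q / t := by
    intro j hj
    have := (mem_Icc.1 hj).1
    exact pow_le_of_le_one hQt0.le hQt (by omega)
  obtain ⟨T, hT⟩ := exists_nat_gt (8 * k * X * B 2 + X * (Fintype.card V * Q) / t + 1)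
  have hT1 : 8 * k * X * B 2 < T := by
    have : 0 ≤ X * (Fintype.card V * Q) / t := by positivity
    linarith
  have hT2 : X * (Fintype.card V * Q) / t < T := by
    have : 0 ≤ 8 * k * X * B 2 := by positivity
    linarith
  have hT0 : (0 : ℝ) < T := lt_of_le_of_lt (by positivity) hT1
  set ε := X / (t * T) with hε
  have hTε : T * ε = X / t := by rw [hε]; field_simp
  have hεt : ε * t = X / T := by rw [hε]; field_simp
  have hpm : 2 * ε * t * B 2 = 2 * X * B 2 / T := by
    rw [mul_assoc 2, hεt]; ring
  have P : Par k ε k t Q B (fun j => 4 * k * B (j + 1) + 1 / X) := by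
    refine ⟨hk, ht0, by positivity, by positivity, hQpos.le, hB0, ?_, ?_, ?_, ?_, ?_⟩
    · rw [div_le_one ht0] at hQt
      nlinarith
    · rw [hpm, div_le_iff₀ hT0]
      nlinarith [mul_pos hX0 (by linarith : 0 < B 2)]
    · rw [hpm]
      have h1 : 1 + 2 * (2 * X * B 2 / T) ≤ Real.exp (4 * X * B 2 / T) := by
        have := Real.add_one_le_exp (4 * X * B 2 / T)
        refine le_trans (le_of_eq ?_) this
        ring
      refine (pow_le_pow_left₀ (by positivity) h1 k).trans ?_
      rw [← Real.exp_nat_mul]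
      have h2 : (k : ℝ) * (4 * X * B 2 / T) ≤ 1 / 2 := by
        rw [mul_div_assoc', div_le_iff₀ hT0]; linarith
      refine (Real.exp_le_exp.2 h2).trans ?_
      have h3 := Real.exp_bound_div_one_sub_of_interval (x := 1 / 2) (by norm_num) (by norm_num)
      norm_num at h3 ⊢
      exact h3
    · intro j hj
      have := hpw j hj
      calc 2 * (k : ℝ) * (Q / t) ^ (j - 1) ≤ 2 * k * (Q / t) := by gcongr
        _ ≤ 26 * (k : ℝ) ^ 2 * Q * (Q / t) := by
          apply mul_le_mul_of_nonneg_right _ hQt0.le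
          have : (k : ℝ) ≤ k ^ 2 * Q := by nlinarith [mul_le_mul_of_nonneg_left hQ1 (by positivity : (0:ℝ) ≤ (k:ℝ)^2)]
          linarith
        _ ≤ 1 := hkey
    · intro j hj
      have h1 := hpw j hj
      have hj2 := (mem_Icc.1 hj).1
      have h2 := hBle j hj2
      have h3 := hBle (j + 1) (by omega)
      have h4 := hB0 j
      have h5 := hB0 (j + 1)
      have h6 : B 2 ≤ B 2 ^ 2 := by nlinarith
      have hk1 : (k : ℝ) ≤ k ^ 2 := by nlinarith
      have e0 : (0:ℝ) ≤ (k : ℝ) ^ 2 := by positivity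
      have : 2 * (k : ℝ) ^ 2 * Q * B j / t +
          2 * (2 * k * (Q / t) ^ (j - 1)) * (2 * k * B (j + 1) + 4 * k * B 2 * B j) ≤ 1 / X := by
        calc _ = 2 * (k : ℝ) ^ 2 * B j * (Q / t) +
            2 * (2 * k * (Q / t) ^ (j - 1)) * (2 * k * B (j + 1) + 4 * k * B 2 * B j) := by ring
          _ ≤ 2 * (k : ℝ) ^ 2 * B 2 ^ 2 * (Q / t) +
            2 * (2 * k * (Q / t)) * (2 * k * B 2 ^ 2 + 4 * k * B 2 * B 2) := by
              gcongr <;> linarith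
          _ = 26 * (k : ℝ) ^ 2 * B 2 ^ 2 * (Q / t) := by ring
          _ ≤ 1 / X := by
              rw [le_div_iff₀ hX0]
              calc _ = 26 * (k : ℝ) ^ 2 * (X * B 2 ^ 2) * (Q / t) := by ring
                _ ≤ 26 * (k : ℝ) ^ 2 * Q * (Q / t) := by gcongr
                _ ≤ 1 := hkey
      linarith
  have := run hG (T := T) P ?_ ?_ ?_ ?_ hdeg
  · rw [hTε] at this; exact this
  · rw [hpm]
    have h1 : 1 + 2 * (2 * X * B 2 / T) ≤ Real.exp (4 * X * B 2 / T) := by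
      have := Real.add_one_le_exp (4 * X * B 2 / T)
      refine le_trans (le_of_eq ?_) this
      ring
    refine (pow_le_pow_left₀ (by positivity) h1 T).trans ?_
    rw [← Real.exp_nat_mul, hQ]
    apply Real.exp_le_exp.2
    apply le_of_eq; field_simp
  · have : ε * (Fintype.card V * Q) = (X * (Fintype.card V * Q) / t) / T := by
      rw [hε]; field_simp
    rw [this, div_lt_one hT0]
    exact hT2
  · intro j
    have := hB0 (j + 1)
    positivity
  · intro j hj
    rw [hTε]
    have hjj := mem_Icc.1 hj
    have e1 : 3 + X / t * t * (4 * k * B (j + 1) + 1 / X) = 4 + 4 * k * X * B (j + 1) := by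
      field_simp; ring
    rw [e1]
    rcases eq_or_lt_of_le hjj.2 with hh | hh
    · subst hh
      simp [hB, BB]
    · have e2 : B j = 8 * k * X * B (j + 1) := by
        simp only [hB, BB, hjj.2, if_true, (by omega : j + 1 ≤ k)]
        rw [show k - j = (k - (j + 1)) + 1 by omega, pow_succ]; ring
      have e3 : 4 ≤ B (j + 1) := by
        simp only [hB, BB, if_true, (by omega : j + 1 ≤ k)]
        have := one_le_pow₀ hY (n := k - (j + 1)); linarith
      rw [e2]
      nlinarith

theorem akpss (k : ℕ) (hk : 2 ≤ k) : ∃ c : ℝ, 0 < c ∧ ∃ t0 : ℝ, ∀ t ≥ t0, ∀ (V : Type) [Fintype V] [DecidableEq V]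
    (E : Finset (Finset V)), Good E k →
    (∀ u, ((E.filter (fun f => u ∈ f)).card : ℝ) ≤ t ^ (k - 1)) →
    ∃ I : Finset V, (∀ f ∈ E, ¬ f ⊆ I) ∧
      c * ((Fintype.card V : ℝ) / t) * Real.log t ^ ((1 : ℝ) / ((k : ℝ) - 1)) ≤ I.card := by
  have hk' : (2 : ℝ) ≤ k := by exact_mod_cast hk
  set c0 : ℝ := 1 / (64 * (8 * k) ^ (k - 2)) with hc0
  have hc0p : 0 < c0 := by positivity
  refine ⟨c0 ^ ((1 : ℝ) / ((k : ℝ) - 1)) / 2, by positivity,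
    max ((26 * (k : ℝ) ^ 2) ^ 2) (Real.exp (1 / c0)), ?_⟩
  intro t ht V _ _ E hG hdeg
  have ht1 : (26 * (k : ℝ) ^ 2) ^ 2 ≤ t := (le_max_left _ _).trans ht
  have ht2 : Real.exp (1 / c0) ≤ t := (le_max_right _ _).trans ht
  have ht0 : 0 < t := (Real.exp_pos _).trans_le ht2
  have hlog : 1 / c0 ≤ Real.log t := (Real.le_log_iff_exp_le ht0).2 ht2
  have hlog0 : 0 < Real.log t := lt_of_lt_of_le (by positivity) hlog
  have h1 : 1 ≤ c0 * Real.log t := by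
    rw [div_le_iff₀ hc0p] at hlog; linarith
  have hexp : 0 < (1 : ℝ) / ((k : ℝ) - 1) := by
    apply div_pos one_pos; linarith
  set X := (c0 * Real.log t) ^ ((1 : ℝ) / ((k : ℝ) - 1)) with hX
  have hX1 : 1 ≤ X := Real.one_le_rpow h1 hexp.le
  have hXk : X ^ (k - 1) = c0 * Real.log t := by
    rw [hX, ← Real.rpow_natCast, ← Real.rpow_mul (by linarith)]
    rw [Nat.cast_sub (by omega), Nat.cast_one, one_div, inv_mul_cancel₀ (by linarith), Real.rpow_one]
  have hcond : 26 * (k : ℝ) ^ 2 * Real.exp (8 * X * (4 * (8 * k * X) ^ (k - 2))) ≤ t := by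
    have e : 8 * X * (4 * (8 * k * X) ^ (k - 2)) = Real.log t * (1 / 2) := by
      have : X ^ (k - 1) = X ^ (k - 2) * X := by rw [← pow_succ]; congr 1; omega
      rw [mul_pow]
      calc _ = 32 * (8 * (k : ℝ)) ^ (k - 2) * (X ^ (k - 2) * X) := by ring
        _ = _ := by rw [← this, hXk, hc0]; field_simp; norm_num
    rw [e, Real.exp_mul, Real.exp_log ht0, ← Real.sqrt_eq_rpow]
    have h3 : 26 * (k : ℝ) ^ 2 ≤ √t := Real.le_sqrt_of_sq_le ht1
    calc _ ≤ √t * √t := by gcongr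
      _ = t := Real.mul_self_sqrt ht0.le
  obtain ⟨I, hI, hI2⟩ := run2 (t := t) hG hk hX1 hcond hdeg
  refine ⟨I, hI, le_trans (le_of_eq ?_) hI2⟩
  rw [hX, Real.mul_rpow hc0p.le hlog0.le]
  ring

end Uncrowded

set_option linter.unusedSectionVars false

namespace Uncrowded
open Finset
section comb
variable {α : Type} [DecidableEq α]

/-- The potential of a family of `r`-sets. -/
def psi (r e : ℕ) (F : Finset (Finset α)) : ℤ :=
  ((e : ℤ) - 1) * ((F.sup id).card - r) - ((F.card : ℤ) - 1) * ((e : ℤ) - 1 - r)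

def Cfg (e : ℕ) (F : Finset (Finset α)) : Prop := F.card = e ∧ (F.sup id).card = e - 1

def Rare (r e : ℕ) (F : Finset (Finset α)) : Prop := 1 ≤ F.card ∧ F.card ≤ 4 * e ∧ psi r e F < 0

variable {r e : ℕ} {S : Finset (Finset α)}

lemma psi_submod (he : 1 ≤ e) (F G : Finset (Finset α)) :
    psi r e (F ∪ G) + psi r e (F ∩ G) ≤ psi r e F + psi r e G := by
  have h1 : (((F ∪ G).sup id).card : ℤ) + ((F ∩ G).sup id).card ≤ (F.sup id).card + (G.sup id).card := by
    have : ((F ∩ G).sup id) ⊆ (F.sup id) ∩ (G.sup id) := by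
      apply subset_inter
      · exact sup_mono inter_subset_left
      · exact sup_mono inter_subset_right
    have h2 := card_le_card this
    have h3 := card_union_add_card_inter (F.sup id) (G.sup id)
    rw [sup_union]
    simp only [sup_eq_union]
    omega
  have h2 := card_union_add_card_inter F G
  have h2' : ((F ∪ G).card : ℤ) = F.card + G.card - (F ∩ G).card := by omega
  unfold psi
  rw [h2']
  have h3 : (0 : ℤ) ≤ (e : ℤ) - 1 := by omega
  nlinarith [mul_le_mul_of_nonneg_left h1 h3]

lemma psi_cfg (he : 1 ≤ e) {g : Finset (Finset α)} (hg : Cfg e g) : psi r e g = 0 := by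
  unfold psi
  rw [hg.1, hg.2, Nat.cast_sub he]
  push_cast; ring

lemma psi_zero (hre : r + 2 ≤ e) (hgcd : Nat.gcd (e - 1) r = 1) {F : Finset (Finset α)}
    (h0 : psi r e F = 0) (h1 : 1 ≤ F.card) (h2 : F.card ≤ e) : F.card = 1 ∨ F.card = e := by
  unfold psi at h0
  have hd : ((e : ℤ) - 1) ∣ ((F.card : ℤ) - 1) * r := by
    refine ⟨((F.card : ℤ) - 1) - ((F.sup id).card - r), ?_⟩
    linear_combination h0
  have hco : IsCoprime ((e : ℤ) - 1) (r : ℤ) := by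
    have : ((e : ℤ) - 1) = ((e - 1 : ℕ) : ℤ) := by omega
    rw [this, Nat.isCoprime_iff_coprime]
    exact hgcd
  have hd2 := hco.dvd_of_dvd_mul_right hd
  obtain ⟨q, hq⟩ := hd2
  have hq0 : 0 ≤ q := by
    by_contra h
    push Not at h
    nlinarith
  have hq1 : q ≤ 1 := by
    by_contra h
    push Not at h
    nlinarith
  interval_cases q
  · left; omega
  · right; omega

lemma glue (hre : r + 2 ≤ e) (hgcd : Nat.gcd (e - 1) r = 1)
    (hS : ∀ F ⊆ S, ¬ Rare r e F) {U g : Finset (Finset α)} (hU : U ⊆ S) (hg : g ⊆ S)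
    (hU0 : psi r e U ≤ 0) (hUc : U.card ≤ 3 * e) (hgc : Cfg e g) (hne : (U ∩ g).Nonempty) :
    psi r e (U ∪ g) ≤ 0 ∧ (2 ≤ (U ∩ g).card → g ⊆ U) := by
  have h1 := psi_submod (r := r) (by omega : 1 ≤ e) U g
  rw [psi_cfg (by omega) hgc] at h1
  have hc1 : 1 ≤ (U ∩ g).card := card_pos.2 hne
  have hc2 : (U ∩ g).card ≤ e := by rw [← hgc.1]; exact card_le_card inter_subset_right
  have hc3 : (U ∪ g).card ≤ 4 * e := by
    have := card_union_le U g; rw [hgc.1] at this; omega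
  have hc4 : 1 ≤ (U ∪ g).card := hc1.trans (card_le_card (inter_subset_left.trans subset_union_left))
  have a1 : 0 ≤ psi r e (U ∩ g) := by
    by_contra h
    exact hS _ (inter_subset_left.trans hU) ⟨hc1, by omega, by omega⟩
  have a2 : 0 ≤ psi r e (U ∪ g) := by
    by_contra h
    exact hS _ (union_subset hU hg) ⟨hc4, hc3, by omega⟩
  refine ⟨by omega, fun h2 => ?_⟩
  rcases psi_zero hre hgcd (by omega : psi r e (U ∩ g) = 0) hc1 hc2 with h | h
  · omega
  · have := eq_of_subset_of_card_le (inter_subset_right (s₁ := U) (s₂ := g)) (by rw [h, hgc.1])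
    rw [← this]; exact inter_subset_left

lemma two_le_card {β : Type*} {s : Finset β} {x y : β} (hx : x ∈ s) (hy : y ∈ s) (h : x ≠ y) :
    2 ≤ s.card := one_lt_card.2 ⟨x, hx, y, hy, h⟩

lemma cfg_lin (hre : r + 2 ≤ e) (hgcd : Nat.gcd (e - 1) r = 1)
    (hS : ∀ F ⊆ S, ¬ Rare r e F) {f g : Finset (Finset α)} (hf : f ⊆ S) (hg : g ⊆ S)
    (hfc : Cfg e f) (hgc : Cfg e g) (h : 2 ≤ (f ∩ g).card) : f = g := by
  have hne : (f ∩ g).Nonempty := card_pos.1 (by omega)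
  have := (glue hre hgcd hS hf hg (psi_cfg (by omega) hfc).le (by rw [hfc.1]; omega) hgc hne).2 h
  exact (eq_of_subset_of_card_le this (by rw [hfc.1, hgc.1])).symm

lemma cfg_good [Fintype α] (hr : 3 ≤ r) (hre : r + 2 ≤ e) (hgcd : Nat.gcd (e - 1) r = 1)
    (hS : ∀ F ⊆ S, ¬ Rare r e F) [DecidablePred (Cfg (α := α) e)] :
    Good (univ.filter fun f : Finset {A // A ∈ S} => Cfg e (f.map (Function.Embedding.subtype _))) e := by
  have hsub : ∀ f : Finset {A // A ∈ S}, f.map (Function.Embedding.subtype _) ⊆ S := by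
    intro f x hx
    simp only [mem_map, Function.Embedding.subtype_apply] at hx
    obtain ⟨a, _, rfl⟩ := hx
    exact a.2
  have hmem : ∀ (f : Finset {A // A ∈ S}) (x : {A // A ∈ S}), x ∈ f →
      x.1 ∈ f.map (Function.Embedding.subtype _) := by
    intro f x hx
    rw [mem_map]; exact ⟨x, hx, rfl⟩
  have inj := map_injective (Function.Embedding.subtype (fun A => A ∈ S))
  have lin : ∀ f g : Finset {A // A ∈ S}, Cfg e (f.map (Function.Embedding.subtype _)) →
      Cfg e (g.map (Function.Embedding.subtype _)) → ∀ x y, x ≠ y → x ∈ f → y ∈ f → x ∈ g → y ∈ g →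
      f = g := by
    intro f g hf hg x y hxy h1 h2 h3 h4
    apply inj
    refine cfg_lin hre hgcd hS (hsub f) (hsub g) hf hg ?_
    exact two_le_card (mem_inter.2 ⟨hmem _ _ h1, hmem _ _ h3⟩) (mem_inter.2 ⟨hmem _ _ h2, hmem _ _ h4⟩)
      (fun h => hxy (Subtype.ext h))
  refine ⟨?_, ?_, ?_, ?_⟩
  · intro f hf
    have := (mem_filter.1 hf).2.1
    rwa [card_map] at this
  · intro f hf g hg
    exact lin f g (mem_filter.1 hf).2 (mem_filter.1 hg).2
  · intro f hf g hg h hh x y z hxy hyz hxz xf yf yg zg zh xh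
    replace hf := (mem_filter.1 hf).2
    replace hg := (mem_filter.1 hg).2
    replace hh := (mem_filter.1 hh).2
    by_contra hfg
    set f' := f.map (Function.Embedding.subtype (fun A => A ∈ S))
    set g' := g.map (Function.Embedding.subtype (fun A => A ∈ S))
    set h' := h.map (Function.Embedding.subtype (fun A => A ∈ S))
    have u1 := (glue hre hgcd hS (hsub f) (hsub g) (psi_cfg (by omega) hf).le (by rw [hf.1]; omega) hg
      ⟨y.1, mem_inter.2 ⟨hmem _ _ yf, hmem _ _ yg⟩⟩).1
    have k1 : (f' ∪ g').card ≤ 3 * e := by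
      have := card_union_le f' g'; rw [hf.1, hg.1] at this; omega
    have u2 := (glue hre hgcd hS (union_subset (hsub f) (hsub g)) (hsub h) u1
      k1 hh
      ⟨x.1, mem_inter.2 ⟨mem_union_left _ (hmem _ _ xf), hmem _ _ xh⟩⟩).2
      (two_le_card (mem_inter.2 ⟨mem_union_left _ (hmem _ _ xf), hmem _ _ xh⟩)
        (mem_inter.2 ⟨mem_union_right _ (hmem _ _ zg), hmem _ _ zh⟩) (fun h => hxz (Subtype.ext h)))
    by_cases c1 : 2 ≤ (h' ∩ f').card
    · have : h = f := inj (cfg_lin hre hgcd hS (hsub h) (hsub f) hh hf c1)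
      subst this
      exact hfg (lin _ _ hf hg y z hyz yf zh yg zg)
    by_cases c2 : 2 ≤ (h' ∩ g').card
    · have : h = g := inj (cfg_lin hre hgcd hS (hsub h) (hsub g) hh hg c2)
      subst this
      exact hfg (lin _ _ hf hg x y hxy xf yf xh yg)
    have : h' ⊆ (h' ∩ f') ∪ (h' ∩ g') := by
      rw [← inter_union_distrib_left]; exact subset_inter subset_rfl u2
    have c3 := (card_le_card this).trans (card_union_le _ _)
    rw [hh.1] at c3
    omega
  · intro f hf g hg h hh l hl x y z q hxy hxz hxq hyz hyq hzq xf yf yg zg zh qh ql xl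
    replace hf := (mem_filter.1 hf).2
    replace hg := (mem_filter.1 hg).2
    replace hh := (mem_filter.1 hh).2
    replace hl := (mem_filter.1 hl).2
    by_contra hcon
    push Not at hcon
    obtain ⟨nfg, ngh, nhl, nlf⟩ := hcon
    set f' := f.map (Function.Embedding.subtype (fun A => A ∈ S))
    set g' := g.map (Function.Embedding.subtype (fun A => A ∈ S))
    set h' := h.map (Function.Embedding.subtype (fun A => A ∈ S))
    set l' := l.map (Function.Embedding.subtype (fun A => A ∈ S))
    have u1 := (glue hre hgcd hS (hsub f) (hsub g) (psi_cfg (by omega) hf).le (by rw [hf.1]; omega) hg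
      ⟨y.1, mem_inter.2 ⟨hmem _ _ yf, hmem _ _ yg⟩⟩).1
    have k1 : (f' ∪ g').card ≤ 2 * e := by
      have := card_union_le f' g'; rw [hf.1, hg.1] at this; omega
    have u2 := (glue hre hgcd hS (union_subset (hsub f) (hsub g)) (hsub h) u1
      (le_trans k1 (by omega)) hh
      ⟨z.1, mem_inter.2 ⟨mem_union_right _ (hmem _ _ zg), hmem _ _ zh⟩⟩).1
    have k2 : (f' ∪ g' ∪ h').card ≤ 3 * e := by
      have := card_union_le (f' ∪ g') h'; rw [hh.1] at this; omega
    have u3 := (glue hre hgcd hS (union_subset (union_subset (hsub f) (hsub g)) (hsub h)) (hsub l) u2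
      k2 hl
      ⟨q.1, mem_inter.2 ⟨mem_union_right _ (hmem _ _ qh), hmem _ _ ql⟩⟩).2
      (two_le_card (mem_inter.2 ⟨mem_union_right _ (hmem _ _ qh), hmem _ _ ql⟩)
        (mem_inter.2 ⟨mem_union_left _ (mem_union_left _ (hmem _ _ xf)), hmem _ _ xl⟩)
        (fun h => hxq (Subtype.ext h.symm)))
    by_cases c1 : 2 ≤ (l' ∩ f').card
    · exact nlf (inj (cfg_lin hre hgcd hS (hsub l) (hsub f) hl hf c1))
    by_cases c2 : 2 ≤ (l' ∩ g').card
    · have : l = g := inj (cfg_lin hre hgcd hS (hsub l) (hsub g) hl hg c2)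
      subst this
      exact nfg (lin _ _ hf hg x y hxy xf yf xl yg)
    by_cases c3 : 2 ≤ (l' ∩ h').card
    · exact nhl (inj (cfg_lin hre hgcd hS (hsub l) (hsub h) hl hh c3)).symm
    have : l' ⊆ (l' ∩ f') ∪ (l' ∩ g') ∪ (l' ∩ h') := by
      rw [← inter_union_distrib_left, ← inter_union_distrib_left]; exact subset_inter subset_rfl u3
    have c4 := (card_le_card this).trans (card_union_le _ _)
    have c5 := card_union_le (l' ∩ f') (l' ∩ g')
    rw [hl.1] at c4
    omega

/-- Families without rare subfamilies and configurations satisfy the span condition. -/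
lemma span_ok (hre : r + 2 ≤ e) (hr : 3 ≤ r) {H : Finset (Finset α)}
    (hS : ∀ F ⊆ H, ¬ Rare r e F) (hC : ∀ F ⊆ H, ¬ Cfg e F) (i : ℕ) (hi : 1 ≤ i) (hie : i ≤ e)
    (T : Finset (Finset α)) (hT : T ⊆ H) (hTc : T.card = i) : i ≤ (T.sup id).card := by
  by_contra hlt
  push Not at hlt
  by_cases hc : i = e ∧ (T.sup id).card = e - 1
  · exact hC T hT ⟨hTc.trans hc.1, hc.2⟩
  apply hS T hT
  refine ⟨by omega, by omega, ?_⟩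
  unfold psi
  rw [hTc]
  set s := (T.sup id).card
  rcases Nat.lt_or_ge i e with h | h
  · have h1 : (s : ℤ) ≤ i - 1 := by omega
    have h2 : ((e : ℤ) - 1) * (s - r) ≤ ((e : ℤ) - 1) * (i - 1 - r) := by
      apply mul_le_mul_of_nonneg_left <;> omega
    have h3 : (r : ℤ) * (i - e) < 0 := by
      apply mul_neg_of_pos_of_neg <;> omega
    nlinarith
  · have hh : i = e := by omega
    subst hh
    have h1 : (s : ℤ) ≤ i - 2 := by omega
    have h2 : ((i : ℤ) - 1) * (s - r) ≤ ((i : ℤ) - 1) * (i - 2 - r) := by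
      apply mul_le_mul_of_nonneg_left <;> omega
    nlinarith

end comb
end Uncrowded

set_option linter.unusedSectionVars false

namespace Uncrowded
open Finset
section samp
variable {β : Type*} [DecidableEq β]

lemma mu_sum (R F : Finset β) (hF : F ⊆ R) (p : ℝ) :
    ∑ S ∈ R.powerset, (p ^ S.card * (1 - p) ^ (R \ S).card) * (if F ⊆ S then 1 else 0) = p ^ F.card := by
  have h := prod_add (fun _ : β => p) (fun i => if i ∈ F then 0 else 1 - p) R
  have e1 : ∏ i ∈ R, (p + if i ∈ F then 0 else 1 - p) = p ^ F.card := by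
    rw [← prod_sdiff hF]
    have a1 : ∏ i ∈ R \ F, (p + if i ∈ F then 0 else 1 - p) = 1 := by
      apply prod_eq_one
      intro i hi
      simp [(mem_sdiff.1 hi).2]
    have a2 : ∏ i ∈ F, (p + if i ∈ F then 0 else 1 - p) = p ^ F.card := by
      rw [← prod_const]
      apply prod_congr rfl
      intro i hi
      simp [hi]
    rw [a1, a2, one_mul]
  rw [← e1, h]
  apply sum_congr rfl
  intro S hS
  rw [prod_const, mul_assoc]
  congr 1
  split_ifs with hc
  · rw [mul_one, ← prod_const]
    apply prod_congr rfl
    intro i hi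
    have : i ∉ F := fun hh => (mem_sdiff.1 hi).2 (hc hh)
    simp [this]
  · obtain ⟨x, hx, hxS⟩ := not_subset.1 hc
    rw [mul_zero]
    symm
    apply prod_eq_zero (mem_sdiff.2 ⟨hF hx, hxS⟩)
    simp [hx]

lemma sample (R : Finset β) (A B : Finset (Finset β)) (hA : ∀ F ∈ A, F ⊆ R) (hB : ∀ F ∈ B, F ⊆ R)
    (p κ : ℝ) (hp0 : 0 ≤ p) (hp1 : p ≤ 1) :
    ∃ S ⊆ R, p * R.card - ∑ F ∈ A, p ^ F.card - κ * ∑ F ∈ B, p ^ F.card ≤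
      S.card - (A.filter (fun F => F ⊆ S)).card - κ * (B.filter (fun F => F ⊆ S)).card := by
  set μ : Finset β → ℝ := fun S => p ^ S.card * (1 - p) ^ (R \ S).card with hμ
  have hμ0 : ∀ S, 0 ≤ μ S := fun S => by
    have : 0 ≤ 1 - p := by linarith
    positivity
  have hμ1 : ∑ S ∈ R.powerset, μ S = 1 := by
    have := mu_sum R ∅ (empty_subset _) p
    simpa using this
  have hcnt : ∀ (C : Finset (Finset β)), (∀ F ∈ C, F ⊆ R) →
      ∑ S ∈ R.powerset, μ S * ((C.filter (fun F => F ⊆ S)).card : ℝ) = ∑ F ∈ C, p ^ F.card := by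
    intro C hC
    have : ∀ S, ((C.filter (fun F => F ⊆ S)).card : ℝ) = ∑ F ∈ C, if F ⊆ S then (1 : ℝ) else 0 := by
      intro S; simp
    simp only [this, mul_sum]
    rw [sum_comm]
    exact sum_congr rfl fun F hF => mu_sum R F (hC F hF) p
  have hcard : ∑ S ∈ R.powerset, μ S * (S.card : ℝ) = p * R.card := by
    have h1 := hcnt (R.image fun a => {a}) (by
      intro F hF
      obtain ⟨a, ha, rfl⟩ := mem_image.1 hF
      exact singleton_subset_iff.2 ha)
    have inj : Set.InjOn (fun a : β => ({a} : Finset β)) R := fun a _ b _ h => singleton_injective h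
    rw [sum_image inj] at h1
    simp only [card_singleton, pow_one, sum_const, nsmul_eq_mul] at h1
    rw [mul_comm p, ← h1]
    apply sum_congr rfl
    intro S hS
    congr 2
    rw [← card_image_of_injective S singleton_injective]
    congr 1
    ext F
    simp only [mem_image, mem_filter]
    constructor
    · rintro ⟨a, ha, rfl⟩
      exact ⟨⟨a, mem_powerset.1 hS ha, rfl⟩, singleton_subset_iff.2 ha⟩
    · rintro ⟨⟨a, ha, rfl⟩, h⟩
      exact ⟨a, singleton_subset_iff.1 h, rfl⟩
  by_contra hcon
  push Not at hcon
  set M := p * R.card - ∑ F ∈ A, p ^ F.card - κ * ∑ F ∈ B, p ^ F.card with hM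
  have e : ∑ S ∈ R.powerset, μ S * ((S.card : ℝ) - (A.filter (fun F => F ⊆ S)).card -
      κ * (B.filter (fun F => F ⊆ S)).card) = M := by
    rw [hM, ← hcard, ← hcnt A hA, ← hcnt B hB, mul_sum, ← sum_sub_distrib, ← sum_sub_distrib]
    apply sum_congr rfl
    intro S _; ring
  have e2 : ∑ S ∈ R.powerset, μ S * ((M - ((S.card : ℝ) - (A.filter (fun F => F ⊆ S)).card -
      κ * (B.filter (fun F => F ⊆ S)).card))) = 0 := by
    have : ∑ S ∈ R.powerset, μ S * (M - ((S.card : ℝ) - (A.filter (fun F => F ⊆ S)).card -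
      κ * (B.filter (fun F => F ⊆ S)).card)) = (∑ S ∈ R.powerset, μ S) * M -
      ∑ S ∈ R.powerset, μ S * ((S.card : ℝ) - (A.filter (fun F => F ⊆ S)).card -
      κ * (B.filter (fun F => F ⊆ S)).card) := by
      rw [sum_mul, ← sum_sub_distrib]
      apply sum_congr rfl
      intro S _; ring
    rw [this, e, hμ1]; ring
  rw [sum_eq_zero_iff_of_nonneg] at e2
  · have : ∀ S ∈ R.powerset, μ S = 0 := by
      intro S hS
      have h1 := e2 S hS
      have h2 := hcon S (mem_powerset.1 hS)
      rcases mul_eq_zero.1 h1 with h | h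
      · exact h
      · linarith
    rw [sum_eq_zero this] at hμ1
    exact zero_ne_one hμ1
  · intro S hS
    have h2 := hcon S (mem_powerset.1 hS)
    exact mul_nonneg (hμ0 S) (by linarith)

lemma extract [Nonempty β] {e : ℕ} (S : Finset β) (A B : Finset (Finset β)) (hA : ∀ F ∈ A, F.Nonempty)
    (hB : ∀ F ∈ B, F.card = e) (D : ℝ) (hD : 0 < D) :
    ∃ S2 ⊆ S, (∀ F ∈ A, ¬ F ⊆ S2) ∧
      (∀ a ∈ S2, ((B.filter (fun F => F ⊆ S ∧ a ∈ F)).card : ℝ) ≤ D) ∧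
      (S.card : ℝ) - (A.filter (fun F => F ⊆ S)).card - e / D * (B.filter (fun F => F ⊆ S)).card ≤
        S2.card := by
  classical
  choose! pick hpick using hA
  set X := (A.filter (fun F => F ⊆ S)).image pick with hX
  set Y := S.filter (fun a => D < ((B.filter (fun F => F ⊆ S ∧ a ∈ F)).card : ℝ)) with hY
  refine ⟨(S \ X) \ Y, sdiff_subset.trans sdiff_subset, ?_, ?_, ?_⟩
  · intro F hF hFS
    have h1 := hFS (hpick F hF)
    have h2 : F ⊆ S := hFS.trans (sdiff_subset.trans sdiff_subset)
    have h3 : pick F ∈ X := mem_image_of_mem _ (mem_filter.2 ⟨hF, h2⟩)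
    exact (mem_sdiff.1 (mem_sdiff.1 h1).1).2 h3
  · intro a ha
    by_contra h
    push Not at h
    have h1 := mem_sdiff.1 ha
    exact h1.2 (mem_filter.2 ⟨(mem_sdiff.1 h1.1).1, h⟩)
  · have hXc : (X.card : ℝ) ≤ (A.filter (fun F => F ⊆ S)).card := by exact_mod_cast card_image_le
    have hYc : (Y.card : ℝ) ≤ e / D * (B.filter (fun F => F ⊆ S)).card := by
      rw [div_mul_eq_mul_div, le_div_iff₀ hD]
      calc (Y.card : ℝ) * D = ∑ a ∈ Y, D := by simp
        _ ≤ ∑ a ∈ Y, ((B.filter (fun F => F ⊆ S ∧ a ∈ F)).card : ℝ) :=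
            sum_le_sum fun a ha => (mem_filter.1 ha).2.le
        _ ≤ ∑ a ∈ S, ((B.filter (fun F => F ⊆ S ∧ a ∈ F)).card : ℝ) :=
            sum_le_sum_of_subset_of_nonneg (filter_subset _ _) fun _ _ _ => by positivity
        _ = ∑ a ∈ S, ∑ F ∈ B.filter (fun F => F ⊆ S), if a ∈ F then (1 : ℝ) else 0 := by
            apply sum_congr rfl
            intro a _
            rw [← filter_filter, ← sum_filter]; simp
        _ = ∑ F ∈ B.filter (fun F => F ⊆ S), (e : ℝ) := by
            rw [sum_comm]
            apply sum_congr rfl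
            intro F hF
            rw [mem_filter] at hF
            rw [← sum_filter, sum_const, nsmul_eq_mul, mul_one, filter_mem_eq_inter,
              inter_eq_right.2 hF.2, hB F hF.1]
        _ = _ := by simp; ring
    have h1 : S.card ≤ X.card + (S \ X).card := by
      have := le_card_sdiff X S; omega
    have h2 : (S \ X).card ≤ Y.card + ((S \ X) \ Y).card := by
      have := le_card_sdiff Y (S \ X); omega
    have h1' : (S.card : ℝ) ≤ X.card + (S \ X).card := by exact_mod_cast h1
    have h2' : ((S \ X).card : ℝ) ≤ Y.card + ((S \ X) \ Y).card := by exact_mod_cast h2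
    linarith

end samp

section count

lemma card_span_le {n r : ℕ} (F : Finset (Finset (Fin n))) (h : ∀ A ∈ F, A.card = r) :
    (F.sup id).card ≤ F.card * r := by
  rw [sup_eq_biUnion]
  exact card_biUnion_le_card_mul _ _ _ fun A hA => (h A hA).le

lemma count {n L : ℕ} (hn : 1 ≤ n) (𝓕 : Finset (Finset (Finset (Fin n))))
    (h : ∀ F ∈ 𝓕, (F.sup id).card ≤ L) :
    ∑ F ∈ 𝓕, ((n : ℝ) ^ (F.sup id).card)⁻¹ ≤ 2 ^ 2 ^ L * (L + 1) := by
  have hn' : (0 : ℝ) < n := by exact_mod_cast hn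
  set W := (univ : Finset (Finset (Fin n))).filter (fun w => w.card ≤ L) with hW
  have h1 := sum_fiberwise_of_maps_to (s := 𝓕) (t := W) (g := fun F => F.sup id)
    (fun F hF => by simp [hW, h F hF]) (fun F => ((n : ℝ) ^ (F.sup id).card)⁻¹)
  rw [← h1]
  calc _ ≤ ∑ w ∈ W, 2 ^ 2 ^ L * ((n : ℝ) ^ w.card)⁻¹ := by
        apply sum_le_sum
        intro w hw
        have e : ∀ F ∈ 𝓕.filter (fun F => F.sup id = w), ((n : ℝ) ^ (F.sup id).card)⁻¹ =
            ((n : ℝ) ^ w.card)⁻¹ := fun F hF => by rw [(mem_filter.1 hF).2]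
        rw [sum_congr rfl e, sum_const, nsmul_eq_mul]
        apply mul_le_mul_of_nonneg_right _ (by positivity)
        have : 𝓕.filter (fun F => F.sup id = w) ⊆ w.powerset.powerset := by
          intro F hF
          rw [mem_powerset]
          intro A hA
          rw [mem_powerset, ← (mem_filter.1 hF).2]
          exact le_sup (f := id) hA
        have h2 := card_le_card this
        rw [card_powerset, card_powerset] at h2
        have h3 : 2 ^ 2 ^ w.card ≤ 2 ^ 2 ^ L := by
          apply Nat.pow_le_pow_right (by norm_num)
          exact Nat.pow_le_pow_right (by norm_num) (mem_filter.1 hw).2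
        exact_mod_cast h2.trans h3
    _ = 2 ^ 2 ^ L * ∑ w ∈ W, ((n : ℝ) ^ w.card)⁻¹ := by rw [mul_sum]
    _ ≤ _ := by
        apply mul_le_mul_of_nonneg_left _ (by positivity)
        have h2 := sum_fiberwise_of_maps_to (s := W) (t := range (L + 1)) (g := fun w => w.card)
          (fun w hw => mem_range.2 (Nat.lt_succ_of_le (mem_filter.1 hw).2))
          (fun w => ((n : ℝ) ^ w.card)⁻¹)
        rw [← h2]
        calc _ ≤ ∑ v ∈ range (L + 1), (1 : ℝ) := by
              apply sum_le_sum
              intro v _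
              have e : ∀ w ∈ W.filter (fun w => w.card = v), ((n : ℝ) ^ w.card)⁻¹ =
                ((n : ℝ) ^ v)⁻¹ := fun w hw => by rw [(mem_filter.1 hw).2]
              rw [sum_congr rfl e, sum_const, nsmul_eq_mul, ← div_eq_mul_inv, div_le_one (by positivity)]
              have : W.filter (fun w => w.card = v) ⊆ powersetCard v univ := by
                intro w hw
                rw [mem_powersetCard]
                exact ⟨subset_univ _, (mem_filter.1 hw).2⟩
              have h3 := card_le_card this
              rw [card_powersetCard, card_univ, Fintype.card_fin] at h3
              exact_mod_cast h3.trans (Nat.choose_le_pow n v)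
          _ = _ := by simp

end count

end Uncrowded

set_option linter.unusedSectionVars false

namespace Uncrowded
open Finset

lemma det {n r e : ℕ} (hr : 3 ≤ r) (hre : r + 2 ≤ e) (hgcd : Nat.gcd (e - 1) r = 1) {c t0 t : ℝ}
    (hak : ∀ t ≥ t0, ∀ (V : Type) [Fintype V] [DecidableEq V]
      (E : Finset (Finset V)), Good E e →
      (∀ u, ((E.filter (fun f => u ∈ f)).card : ℝ) ≤ t ^ (e - 1)) →
      ∃ I : Finset V, (∀ f ∈ E, ¬ f ⊆ I) ∧
        c * ((Fintype.card V : ℝ) / t) * Real.log t ^ ((1 : ℝ) / ((e : ℝ) - 1)) ≤ I.card)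
    (ht : t0 ≤ t) (S S2 : Finset (Finset (Fin n))) (B : Finset (Finset (Finset (Fin n))))
    (hS2 : S2 ⊆ S) (hB : ∀ F ⊆ S, Cfg e F → F ∈ B)
    (hR : ∀ F ⊆ S2, ¬ Rare r e F)
    (hdeg : ∀ a ∈ S2, ((B.filter (fun F => F ⊆ S ∧ a ∈ F)).card : ℝ) ≤ t ^ (e - 1)) :
    ∃ H ⊆ S2, c * ((S2.card : ℝ) / t) * Real.log t ^ ((1 : ℝ) / ((e : ℝ) - 1)) ≤ H.card ∧
      ∀ F ⊆ H, ¬ Cfg e F := by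
  classical
  have hG := cfg_good hr hre hgcd hR
  set E := univ.filter fun f : Finset {A // A ∈ S2} => Cfg e (f.map (Function.Embedding.subtype _))
    with hE
  have hsub : ∀ f : Finset {A // A ∈ S2}, f.map (Function.Embedding.subtype _) ⊆ S2 := by
    intro f x hx
    simp only [mem_map, Function.Embedding.subtype_apply] at hx
    obtain ⟨a, _, rfl⟩ := hx
    exact a.2
  obtain ⟨I, hI, hIc⟩ := hak t ht {A // A ∈ S2} E hG (by
    intro u
    refine le_trans ?_ (hdeg u.1 u.2)
    norm_cast
    apply card_le_card_of_injOn (fun f => f.map (Function.Embedding.subtype _))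
    · intro f hf
      simp only [coe_filter, Set.mem_setOf_eq, hE, mem_filter, mem_univ, true_and] at hf ⊢
      have hfs := (hsub f).trans hS2
      refine ⟨hB _ hfs hf.1, hfs, ?_⟩
      rw [mem_map]
      exact ⟨u, hf.2, rfl⟩
    · intro a _ b _ h
      exact map_injective _ h)
  refine ⟨I.map (Function.Embedding.subtype _), hsub I, ?_, ?_⟩
  · rw [card_map]
    rw [Fintype.card_coe] at hIc
    exact hIc
  · intro F hF hFc
    set f : Finset {A // A ∈ S2} := I.filter (fun a => a.1 ∈ F) with hf
    have hfF : f.map (Function.Embedding.subtype _) = F := by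
      ext A
      simp only [mem_map, hf, mem_filter, Function.Embedding.subtype_apply]
      constructor
      · rintro ⟨a, ⟨_, h⟩, rfl⟩; exact h
      · intro hA
        obtain ⟨a, ha, hh⟩ := mem_map.1 (hF hA)
        simp only [Function.Embedding.subtype_apply] at hh
        exact ⟨a, ⟨ha, by rw [hh]; exact hA⟩, hh⟩
    apply hI f
    · rw [hE, mem_filter]
      refine ⟨mem_univ _, ?_⟩
      rw [hfF]; exact hFc
    · exact filter_subset _ _

lemma choose_lower (r n : ℕ) (h : 2 * r ≤ n) :
    (1 / (2 ^ r * (r.factorial : ℝ))) * (n : ℝ) ^ r ≤ n.choose r := by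
  refine le_trans ?_ (Nat.pow_le_choose (α := ℝ) r n)
  have h1 : (n : ℝ) / 2 ≤ ((n + 1 - r : ℕ) : ℝ) := by
    have : n ≤ 2 * (n + 1 - r) := by omega
    have : (n : ℝ) ≤ 2 * ((n + 1 - r : ℕ) : ℝ) := by exact_mod_cast this
    linarith
  have h2 := pow_le_pow_left₀ (by positivity) h1 r
  rw [div_pow] at h2
  calc _ = (n : ℝ) ^ r / 2 ^ r / r.factorial := by field_simp
    _ ≤ _ := by gcongr

lemma pow_identity {n r e : ℕ} (he : 2 ≤ e) (hn : 1 ≤ n) (δ : ℝ) (F : Finset (Finset (Fin n))) :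
    ((n : ℝ) ^ (-1 + (r : ℝ) / ((e : ℝ) - 1) + δ)) ^ F.card =
      ((n : ℝ) ^ r * (n : ℝ) ^ (-1 + (r : ℝ) / ((e : ℝ) - 1) + δ)) *
      (n : ℝ) ^ ((psi r e F : ℝ) / ((e : ℝ) - 1) + δ * ((F.card : ℝ) - 1)) *
      ((n : ℝ) ^ (F.sup id).card)⁻¹ := by
  have hn' : (0 : ℝ) < n := by exact_mod_cast hn
  have he' : (2 : ℝ) ≤ e := by exact_mod_cast he
  have he0 : (e : ℝ) - 1 ≠ 0 := by linarith
  rw [← Real.rpow_natCast (n : ℝ) r, ← Real.rpow_natCast (n : ℝ) (F.sup id).card,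
    ← Real.rpow_neg hn'.le, ← Real.rpow_natCast, ← Real.rpow_mul hn'.le,
    ← Real.rpow_add hn', ← Real.rpow_add hn', ← Real.rpow_add hn']
  congr 1
  unfold psi
  push_cast
  field_simp
  ring

end Uncrowded


namespace Uncrowded

open Finset in
theorem main_result (r e : ℕ) (hr : 3 ≤ r) (he : r < e) (hgcd : Nat.gcd (e - 1) r = 1) :
    ∃ c : ℝ, 0 < c ∧ ∃ N : ℕ, ∀ n : ℕ, N ≤ n →
      ∃ H : Finset (Finset (Fin n)),
        (∀ A ∈ H, A.card = r) ∧
        c * (n : ℝ) ^ ((r : ℝ) - 1 + (r : ℝ) / ((e : ℝ) - 1)) *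
          Real.log n ^ ((1 : ℝ) / ((e : ℝ) - 1)) ≤ H.card ∧
        ∀ i : ℕ, 1 ≤ i → i ≤ e → ∀ S ⊆ H, S.card = i → i ≤ (S.sup id).card := by

  classical
  have hre : r + 2 ≤ e := by
    by_contra h
    have : e - 1 = r := by omega
    rw [this, Nat.gcd_self] at hgcd
    omega
  have he' : (5 : ℝ) ≤ e := by exact_mod_cast (by omega : 5 ≤ e)
  have hre' : (r : ℝ) + 2 ≤ e := by exact_mod_cast hre
  obtain ⟨c, hc, t0, hak⟩ := akpss e (by omega)
  set x : ℝ := (1 : ℝ) / ((e : ℝ) - 1) with hx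
  have hx0 : 0 ≤ x := by apply div_nonneg zero_le_one; linarith
  set δ : ℝ := 1 / (8 * e * ((e : ℝ) - 1)) with hδ
  have he1 : 0 < (e : ℝ) - 1 := by linarith
  have hδ0 : 0 < δ := by positivity
  set L : ℕ := 4 * e * r with hL
  set K : ℝ := 2 ^ 2 ^ L * (L + 1) with hK
  have hK1 : 1 ≤ K := by
    have h1 : (1 : ℝ) ≤ 2 ^ 2 ^ L := one_le_pow₀ (by norm_num)
    have h2 : (1 : ℝ) ≤ (L : ℝ) + 1 := by linarith [Nat.cast_nonneg (α := ℝ) L]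
    exact one_le_mul_of_one_le_of_one_le h1 h2
  set c1 : ℝ := 1 / (2 ^ r * (r.factorial : ℝ)) with hc1
  have hfac : (1 : ℝ) ≤ r.factorial := by exact_mod_cast Nat.one_le_iff_ne_zero.2 (Nat.factorial_ne_zero r)
  have hc10 : 0 < c1 := by positivity
  have hc11 : c1 ≤ 1 := by
    rw [hc1, div_le_one (by positivity)]
    exact one_le_mul_of_one_le_of_one_le (one_le_pow₀ (by norm_num)) hfac
  set C : ℝ := 4 * e * K / c1 with hC
  have hC1 : 1 ≤ C := by
    rw [hC, le_div_iff₀ hc10]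
    nlinarith
  have hev : ∀ᶠ n : ℕ in Filter.atTop, 2 * r ≤ n ∧ 2 ≤ n ∧
      K * (n : ℝ) ^ (-(1 / (2 * ((e : ℝ) - 1)))) ≤ c1 / 4 ∧ t0 ≤ C * (n : ℝ) ^ δ := by
    refine (Filter.eventually_ge_atTop (2 * r)).and ((Filter.eventually_ge_atTop 2).and (Filter.Eventually.and ?_ ?_))
    · have h1 : Filter.Tendsto (fun n : ℕ => K * (n : ℝ) ^ (-(1 / (2 * ((e : ℝ) - 1)))))
          Filter.atTop (nhds (K * 0)) :=
        ((tendsto_rpow_neg_atTop (by positivity)).comp tendsto_natCast_atTop_atTop).const_mul K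
      rw [mul_zero] at h1
      exact (h1.eventually (gt_mem_nhds (by positivity : 0 < c1 / 4))).mono fun n hn => hn.le
    · have h1 : Filter.Tendsto (fun n : ℕ => C * (n : ℝ) ^ δ) Filter.atTop Filter.atTop :=
        ((tendsto_rpow_atTop hδ0).comp tendsto_natCast_atTop_atTop).const_mul_atTop (by linarith)
      exact h1.eventually_ge_atTop t0
  obtain ⟨N, hN⟩ := Filter.eventually_atTop.1 hev
  refine ⟨c * c1 / (2 * C) * δ ^ x, by positivity, N, ?_⟩
  intro n hn
  obtain ⟨hn1, hn2, hn3, hn4⟩ := hN n hn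
  have hnr : (2 : ℝ) ≤ n := by exact_mod_cast hn2
  have hn0 : (0 : ℝ) < n := by linarith
  set y : ℝ := -1 + (r : ℝ) / ((e : ℝ) - 1) + δ with hy
  set p : ℝ := (n : ℝ) ^ y with hp
  have hp0 : 0 < p := Real.rpow_pos_of_pos hn0 _
  have hy0 : y ≤ 0 := by
    have h1 : (r : ℝ) / ((e : ℝ) - 1) ≤ ((e : ℝ) - 2) / ((e : ℝ) - 1) := by gcongr; linarith
    have h2 : ((e : ℝ) - 2) / ((e : ℝ) - 1) = 1 - 1 / ((e : ℝ) - 1) := by field_simp; ring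
    have h3 : δ ≤ 1 / ((e : ℝ) - 1) := by
      rw [hδ]
      apply one_div_le_one_div_of_le he1
      nlinarith
    linarith
  have hp1 : p ≤ 1 := Real.rpow_le_one_of_one_le_of_nonpos (by linarith) hy0
  set M : ℝ := (n : ℝ) ^ r * p with hM
  have hM0 : 0 < M := by positivity
  set R : Finset (Finset (Fin n)) := powersetCard r univ with hR
  have hRcard : ∀ A ∈ R, A.card = r := fun A hA => (mem_powersetCard.1 hA).2
  set 𝓐 := R.powerset.filter (Rare r e) with hA
  set 𝓑 := R.powerset.filter (Cfg e) with hB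
  have hspan : ∀ F ∈ R.powerset, F.card ≤ 4 * e → (F.sup id).card ≤ L := by
    intro F hF hFc
    refine (card_span_le F fun A hA => hRcard A (mem_powerset.1 hF hA)).trans ?_
    exact Nat.mul_le_mul_right r hFc
  -- rare families
  have hAsum : ∑ F ∈ 𝓐, p ^ F.card ≤ M * (c1 / 4) := by
    have h1 : ∀ F ∈ 𝓐, p ^ F.card ≤ M * (n : ℝ) ^ (-(1 / (2 * ((e : ℝ) - 1)))) *
        ((n : ℝ) ^ (F.sup id).card)⁻¹ := by
      intro F hF
      obtain ⟨hF1, hF2, hF3, hF4⟩ := mem_filter.1 hF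
      rw [hp, hy, pow_identity (by omega) (by omega)]
      apply mul_le_mul_of_nonneg_right _ (by positivity)
      apply mul_le_mul_of_nonneg_left _ hM0.le
      apply Real.rpow_le_rpow_of_exponent_le (by linarith)
      have q1 : (psi r e F : ℝ) ≤ -1 := by exact_mod_cast (by omega : psi r e F ≤ -1)
      have q2 : (F.card : ℝ) ≤ 4 * e := by exact_mod_cast hF3
      have q3 : (psi r e F : ℝ) / ((e : ℝ) - 1) ≤ -1 / ((e : ℝ) - 1) := by gcongr
      have q4 : δ * ((F.card : ℝ) - 1) ≤ δ * (4 * e) := by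
        apply mul_le_mul_of_nonneg_left _ hδ0.le; linarith
      have q5 : δ * (4 * e) = 1 / (2 * ((e : ℝ) - 1)) := by rw [hδ]; field_simp; norm_num
      have q6 : -1 / ((e : ℝ) - 1) + 1 / (2 * ((e : ℝ) - 1)) = -(1 / (2 * ((e : ℝ) - 1))) := by
        field_simp; norm_num
      linarith
    refine (sum_le_sum h1).trans ?_
    rw [← mul_sum, mul_assoc]
    apply mul_le_mul_of_nonneg_left _ hM0.le
    refine le_trans ?_ hn3
    rw [mul_comm K]
    apply mul_le_mul_of_nonneg_left _ (by positivity)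
    exact count (by omega) _ fun F hF => hspan F (mem_filter.1 hF).1 (mem_filter.1 hF).2.2.1
  have hBsum : ∑ F ∈ 𝓑, p ^ F.card ≤ M * (n : ℝ) ^ (δ * ((e : ℝ) - 1)) * K := by
    have h1 : ∀ F ∈ 𝓑, p ^ F.card = M * (n : ℝ) ^ (δ * ((e : ℝ) - 1)) *
        ((n : ℝ) ^ (F.sup id).card)⁻¹ := by
      intro F hF
      have hFc := (mem_filter.1 hF).2
      rw [hp, hy, pow_identity (by omega) (by omega), psi_cfg (by omega) hFc, hFc.1]
      simp only [Int.cast_zero, zero_div, zero_add, ← hM]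
      rfl
    rw [sum_congr rfl h1, ← mul_sum]
    apply mul_le_mul_of_nonneg_left _ (by positivity)
    refine count (by omega) _ fun F hF => hspan F (mem_filter.1 hF).1 ?_
    rw [(mem_filter.1 hF).2.1]; omega
  set t : ℝ := C * (n : ℝ) ^ δ with ht
  have ht0 : 0 < t := by positivity
  have hD : C * (n : ℝ) ^ (δ * ((e : ℝ) - 1)) ≤ t ^ (e - 1) := by
    rw [ht, mul_pow]
    apply mul_le_mul
    · exact le_self_pow₀ hC1 (by omega)
    · rw [← Real.rpow_natCast, ← Real.rpow_mul hn0.le, Nat.cast_sub (by omega), Nat.cast_one]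
    · positivity
    · positivity
  obtain ⟨S, hSR, hS⟩ := sample R 𝓐 𝓑 (fun F hF => mem_powerset.1 (mem_filter.1 hF).1)
    (fun F hF => mem_powerset.1 (mem_filter.1 hF).1) p (e / t ^ (e - 1)) hp0.le hp1
  obtain ⟨S2, hS2S, hS2A, hS2deg, hS2c⟩ := extract (e := e) S 𝓐 𝓑
    (fun F hF => card_pos.1 (mem_filter.1 hF).2.1) (fun F hF => (mem_filter.1 hF).2.1)
    (t ^ (e - 1)) (by positivity)
  have hRare : ∀ F ⊆ S2, ¬ Rare r e F := fun F hF hFr =>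
    hS2A F (mem_filter.2 ⟨mem_powerset.2 (hF.trans (hS2S.trans hSR)), hFr⟩) hF
  obtain ⟨H, hHS, hHc, hHcfg⟩ := det hr hre hgcd hak hn4 S S2 𝓑 hS2S
    (fun F hF hFc => mem_filter.2 ⟨mem_powerset.2 (hF.trans hSR), hFc⟩) hRare hS2deg
  refine ⟨H, fun A hA => hRcard A (hSR (hS2S (hHS hA))), ?_, fun i hi hie T hT hTc =>
    span_ok hre hr (fun F hF => hRare F (hF.trans hHS)) hHcfg i hi hie T hT hTc⟩
  refine le_trans ?_ hHc
  have hRc : c1 * M ≤ p * R.card := by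
    rw [hR, card_powersetCard, card_univ, Fintype.card_fin]
    have := mul_le_mul_of_nonneg_left (choose_lower r n hn1) hp0.le
    refine le_trans (le_of_eq ?_) this
    rw [hM]; ring
  have hBs : e / t ^ (e - 1) * ∑ F ∈ 𝓑, p ^ F.card ≤ M * (c1 / 4) := by
    rw [div_mul_eq_mul_div, div_le_iff₀ (by positivity)]
    calc (e : ℝ) * ∑ F ∈ 𝓑, p ^ F.card ≤ e * (M * (n : ℝ) ^ (δ * ((e : ℝ) - 1)) * K) := by gcongr
      _ = M * (c1 / 4) * (C * (n : ℝ) ^ (δ * ((e : ℝ) - 1))) := by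
          rw [hC]; field_simp
      _ ≤ _ := by gcongr
  have hS2M : c1 * M / 2 ≤ S2.card := by linarith
  have hlogn : 0 < Real.log n := Real.log_pos (by linarith)
  have hlog : δ * Real.log n ≤ Real.log t := by
    rw [ht, Real.log_mul (by positivity) (by positivity), Real.log_rpow hn0]
    have := Real.log_nonneg hC1
    linarith
  have hpow : M / (n : ℝ) ^ δ = (n : ℝ) ^ ((r : ℝ) - 1 + (r : ℝ) / ((e : ℝ) - 1)) := by
    rw [hM, hp, ← Real.rpow_natCast, ← Real.rpow_add hn0, ← Real.rpow_sub hn0, hy]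
    congr 1; ring
  calc _ = c * ((c1 * M / 2) / t) * (δ * Real.log n) ^ x := by
        rw [Real.mul_rpow hδ0.le hlogn.le, ← hpow, ht]
        field_simp
    _ ≤ _ := by gcongr

end Uncrowded

/-- Proposition 4.5: for fixed `e > r ≥ 3` with `gcd(e-1, r) = 1`,
`ex_r(n, ℋ_r(0,e)) = Ω(n^(r-1+r/(e-1)) (log n)^(1/(e-1)))`: for all large `n` there is an
`r`-graph on `[n]` with that many edges in which any `i` distinct edges (`1 ≤ i ≤ e`) span at
least `i` vertices. -/
theorem stmt_16 (r e : ℕ) (hr : 3 ≤ r) (he : r < e) (hgcd : Nat.gcd (e - 1) r = 1) :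
    ∃ c : ℝ, 0 < c ∧ ∃ N : ℕ, ∀ n : ℕ, N ≤ n →
      ∃ H : Finset (Finset (Fin n)),
        (∀ A ∈ H, A.card = r) ∧
        c * (n : ℝ) ^ ((r : ℝ) - 1 + (r : ℝ) / ((e : ℝ) - 1)) *
          Real.log n ^ ((1 : ℝ) / ((e : ℝ) - 1)) ≤ H.card ∧
        ∀ i : ℕ, 1 ≤ i → i ≤ e → ∀ S ⊆ H, S.card = i → i ≤ (S.sup id).card := by
  exact Uncrowded.main_result r e hr he hgcd
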